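/- In the Setup, let x be a point in X and γ a geodesic from x̂ to x. Suppose there is an r-chain {x_i}_{i=0}^m from x = x₀ to a point x_m ∈ γ such that all points of the chain, except possibly x_m, have the same c*_X-color 𝔠. Denote by γ' the subpath of γ between x and x_m, and assume that whenever a long piece γ_P of γ intersects γ', either γ_P ⊆ γ' or γ_P ∩ γ' = {x_m}. Then d(x, x_m) ≤ 140·f(r). -/

import Mathlib

open Set Metric

section Core

variable {X : Type*} [MetricSpace X]

/-- A geodesic segment parametrized by the interval `[a, b]`:
an isometric embedding of `[a, b]` into `X`. -/
def IsGeodesicSegment (γ : ℝ → X) (a b : ℝ) : Prop :=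
  ∀ s ∈ Set.Icc a b, ∀ t ∈ Set.Icc a b, dist (γ s) (γ t) = |s - t|

/-- A metric space is geodesic if every two points are joined by a geodesic. -/
def GeodesicSpace (X : Type*) [MetricSpace X] : Prop :=
  ∀ x y : X, ∃ γ : ℝ → X, IsGeodesicSegment γ 0 (dist x y) ∧ γ 0 = x ∧ γ (dist x y) = y

/-- A subset is geodesic if every two of its points are joined by a geodesic of `X`
contained in the subset. -/
def IsGeodesicSubset (S : Set X) : Prop :=
  ∀ x ∈ S, ∀ y ∈ S, ∃ γ : ℝ → X, IsGeodesicSegment γ 0 (dist x y) ∧ γ 0 = x ∧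
    γ (dist x y) = y ∧ ∀ t ∈ Set.Icc (0 : ℝ) (dist x y), γ t ∈ S

/-- A (complete geodesic) metric space is tree-graded with respect to a collection `PX`
of closed geodesic subsets (pieces) covering `X` if every two different pieces meet in
at most one point (T₁) and every simple loop (injective continuous image of a circle)
is contained in one piece (T₂''). -/
structure IsTreeGraded (X : Type*) [MetricSpace X] (PX : Set (Set X)) : Prop where
  nonempty : ∀ P ∈ PX, P.Nonempty
  closed : ∀ P ∈ PX, IsClosed P
  geodesicSub : ∀ P ∈ PX, IsGeodesicSubset P
  covers : ∀ x : X, ∃ P ∈ PX, x ∈ P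
  t1 : ∀ P ∈ PX, ∀ Q ∈ PX, P ≠ Q → (P ∩ Q).Subsingleton
  t2 : ∀ loop : AddCircle (1 : ℝ) → X, Continuous loop → Function.Injective loop →
    ∃ P ∈ PX, Set.range loop ⊆ P

end Core
section Chains

variable {Y : Type*}

/-- An `r`-chain from `x` to `y` inside the set `S`, with respect to the distance
function `d`: a finite sequence `x = c 0, c 1, …, c m = y` of points of `S` with
consecutive distances `< r`. -/
def IsDChain (d : Y → Y → ℝ) (r : ℝ) (S : Set Y) (x y : Y) : Prop :=
  ∃ (m : ℕ) (c : ℕ → Y), c 0 = x ∧ c m = y ∧ (∀ i ≤ m, c i ∈ S) ∧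
    ∀ i < m, d (c i) (c (i + 1)) < r

/-- A set is `r`-scale connected if every two of its points are joined by an
`r`-chain contained in it. -/
def DScaleConnected (d : Y → Y → ℝ) (r : ℝ) (S : Set Y) : Prop :=
  ∀ x ∈ S, ∀ y ∈ S, IsDChain d r S x y

/-- `C` is an `r`-scale connected component of `U`: a maximal `r`-scale connected
subset of `U`. -/
def IsDComponent (d : Y → Y → ℝ) (r : ℝ) (U C : Set Y) : Prop :=
  C ⊆ U ∧ DScaleConnected d r C ∧
    ∀ C', C ⊆ C' → C' ⊆ U → DScaleConnected d r C' → C = C'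

/-- A set is `M`-bounded: its diameter is at most `M`. -/
def DBounded (d : Y → Y → ℝ) (M : ℝ) (S : Set Y) : Prop :=
  ∀ x ∈ S, ∀ y ∈ S, d x y ≤ M

/-- A space has dimension `≤ n` at scale `s` of magnitude `M` if there is a cover by
`n + 1` sets such that every `s`-scale connected component of each of them is
`M`-bounded. -/
def DimLeAtScale (d : Y → Y → ℝ) (n : ℕ) (s M : ℝ) : Prop :=
  ∃ U : Fin (n + 1) → Set Y, (∀ y, ∃ i, y ∈ U i) ∧
    ∀ i C, IsDComponent d s (U i) C → DBounded d M C

end Chains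
section TreeGradedColoring

variable {X : Type*} [MetricSpace X]

/-- The `r`-scale connected component `𝔠_P` of `c_P`-color `0` of the piece `P`
containing its base point `x_P = proj P x̂`: the set of points of `P` reachable from
`x_P` by an `r`-chain of points of `P` of `c_P`-color `0`. -/
def pieceComp (r : ℝ) {n : ℕ} (xhat : X) (proj : Set X → X → X)
    (cP : Set X → X → Fin (n + 1)) (P : Set X) : Set X :=
  {y | IsDChain dist r {z | z ∈ P ∧ cP P z = 0} (proj P xhat) y}

/-- `P` is a long piece of the geodesic `γ : [0, L] → X` (from `x̂` to `x = γ L`):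
`γ` meets `P` and the exit point `π_P x` does not belong to `𝔠_P`. -/
def IsLongPiece (PX : Set (Set X)) (r : ℝ) {n : ℕ} (xhat : X)
    (proj : Set X → X → X) (cP : Set X → X → Fin (n + 1))
    (γ : ℝ → X) (L : ℝ) (P : Set X) : Prop :=
  P ∈ PX ∧ (∃ t ∈ Set.Icc 0 L, γ t ∈ P) ∧
    proj P (γ L) ∉ pieceComp r xhat proj cP P

/-- The parameter at which the geodesic `γ : [0, L] → X` enters the piece `P`. -/
noncomputable def pieceStart (γ : ℝ → X) (L : ℝ) (P : Set X) : ℝ :=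
  sInf {t | t ∈ Set.Icc 0 L ∧ γ t ∈ P}

/-- The parameter at which the geodesic `γ : [0, L] → X` exits the piece `P`. -/
noncomputable def pieceEnd (γ : ℝ → X) (L : ℝ) (P : Set X) : ℝ :=
  sSup {t | t ∈ Set.Icc 0 L ∧ γ t ∈ P}

/-- The complement in `γ : [0, L] → X` (in parameter space) of the interiors of all
reduced long pieces of `γ`; its connected components are the subpaths `β₁, …, β_k`. -/
noncomputable def betaSet (PX : Set (Set X)) (r : ℝ) {n : ℕ} (xhat : X)
    (proj : Set X → X → X) (cP : Set X → X → Fin (n + 1))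
    (γ : ℝ → X) (L : ℝ) : Set ℝ :=
  Set.Icc 0 L \
    ⋃ P ∈ {P | IsLongPiece PX r xhat proj cP γ L P},
      Set.Ioo (pieceStart γ L P + r / 2) (pieceEnd γ L P)

/-- The length `|⌊β⌋|` of the initial part of the subpath `β = γ|[a,b]`, where
`⌊β⌋` goes from `β₋ = γ a` to the entry point `β′` of the piece of the induced
tree-graded structure on `β` containing `β₊ = γ b`. -/
noncomputable def floorLen (PX : Set (Set X)) (γ : ℝ → X) (a b : ℝ) : ℝ :=
  sInf {t | t ∈ Set.Icc a b ∧ ∃ P ∈ PX, γ '' Set.Icc t b ⊆ P} - a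

/-- `v` is the value at `x = γ L` of the coloring `c*_X` computed along the geodesic
`γ : [0, L] → X` from `x̂` to `x`:
`v = Σ_P c_P(π_P x) + Σᵢ ⌊ |⌊βᵢ⌋| / (99 f(r)) ⌋ (mod n+1)`,
where the first sum is over the (finitely many) pieces with a nonzero term and
`β₁, …, β_k` are the connected components of the complement in `γ` of the interiors
of the reduced long pieces of `γ`. -/
def ColorValue (PX : Set (Set X)) (r fr : ℝ) {n : ℕ} (xhat : X)
    (proj : Set X → X → X) (cP : Set X → X → Fin (n + 1))
    (γ : ℝ → X) (L : ℝ) (v : Fin (n + 1)) : Prop :=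
  ∃ (Ps : Finset (Set X)) (k : ℕ) (a b : Fin k → ℝ),
    (↑Ps : Set (Set X)) = {P | P ∈ PX ∧ cP P (proj P (γ L)) ≠ 0} ∧
    (∀ i, a i ≤ b i) ∧
    (betaSet PX r xhat proj cP γ L = ⋃ i, Set.Icc (a i) (b i)) ∧
    (∀ i j, i ≠ j → b i < a j ∨ b j < a i) ∧
    (v : ℕ) =
      ((Ps.sum fun P => ((cP P (proj P (γ L)) : ℕ))) +
        (Finset.univ.sum fun i : Fin k =>
          Nat.floor (floorLen PX γ (a i) (b i) / (99 * fr)))) % (n + 1)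

/-- The Setup: `X` is a geodesic metric space, tree-graded with respect to `PX`, pieces
do not contain other pieces; `n` is a positive integer, `r > 0` and `f(r) ≥ r`;
`proj P` is the nearest-point projection onto the piece `P`; `x̂` is a base point and
`x_P = proj P x̂`; `c_P` is a coloring of each piece `P` by `n + 1` colors such that
`r`-components of every nonzero color are `f(r)`-bounded, `r`-components of color `0`
are `8 f(r)`-bounded, and `c_P` vanishes on the closed ball `B(x_P, 2r)`. -/
structure ColoringSetup (X : Type*) [MetricSpace X] (PX : Set (Set X)) (n : ℕ)
    (r fr : ℝ) (xhat : X) (proj : Set X → X → X)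
    (cP : Set X → X → Fin (n + 1)) : Prop where
  geodesic : GeodesicSpace X
  treeGraded : IsTreeGraded X PX
  noPieceContainsPiece : ∀ P ∈ PX, ∀ Q ∈ PX, P ⊆ Q → P = Q
  npos : 0 < n
  rpos : 0 < r
  rlefr : r ≤ fr
  projMem : ∀ P ∈ PX, ∀ x : X, proj P x ∈ P
  projDist : ∀ P ∈ PX, ∀ x : X, dist x (proj P x) = Metric.infDist x P
  ballZero : ∀ P ∈ PX, ∀ y ∈ P, dist y (proj P xhat) ≤ 2 * r → cP P y = 0
  nonzeroBounded : ∀ P ∈ PX, ∀ j : Fin (n + 1), j ≠ 0 →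
    ∀ x y : X, IsDChain dist r {z | z ∈ P ∧ cP P z = j} x y → dist x y ≤ fr
  zeroBounded : ∀ P ∈ PX, ∀ x y : X,
    IsDChain dist r {z | z ∈ P ∧ cP P z = 0} x y → dist x y ≤ 8 * fr

end TreeGradedColoring

section Arcs

variable {X : Type*} [MetricSpace X]

/-- There is an arc (possibly reduced to a point) from `a` to `b` inside `S`. -/
def ArcIn (S : Set X) (a b : X) : Prop :=
  ∃ (f : ℝ → X) (l : ℝ), 0 ≤ l ∧ Continuous f ∧ Set.InjOn f (Set.Icc 0 l) ∧
    f 0 = a ∧ f l = b ∧ ∀ t ∈ Set.Icc 0 l, f t ∈ S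

theorem ArcIn.mono {S T : Set X} {a b : X} (h : ArcIn S a b) (hST : S ⊆ T) : ArcIn T a b := by
  obtain ⟨f, l, hl, hc, hi, h0, h1, hS⟩ := h
  exact ⟨f, l, hl, hc, hi, h0, h1, fun t ht => hST (hS t ht)⟩

theorem ArcIn.refl {S : Set X} {a : X} (h : a ∈ S) : ArcIn S a a := by
  refine ⟨fun _ => a, 0, le_rfl, continuous_const, ?_, rfl, rfl, fun _ _ => h⟩
  intro s hs t ht _
  linarith [hs.1, hs.2, ht.1, ht.2]

theorem arcIn_of_subinterval {S : Set X} {f : ℝ → X} {p q : ℝ} (hpq : p ≤ q)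
    (hc : Continuous f) (hi : Set.InjOn f (Set.Icc p q)) (hS : ∀ t ∈ Set.Icc p q, f t ∈ S) :
    ArcIn S (f p) (f q) := by
  refine ⟨fun t => f (p + t), q - p, by linarith, by fun_prop, ?_, by simp, by simp, ?_⟩
  · intro s hs t ht hst
    have := hi (x₁ := p + s) (x₂ := p + t) ⟨by linarith [hs.1], by linarith [hs.2]⟩
      ⟨by linarith [ht.1], by linarith [ht.2]⟩ hst
    linarith
  · intro t ht
    exact hS _ ⟨by linarith [ht.1], by linarith [ht.2]⟩

theorem ArcIn.symm {S : Set X} {a b : X} (h : ArcIn S a b) : ArcIn S b a := by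
  obtain ⟨f, l, hl, hc, hi, h0, h1, hS⟩ := h
  refine ⟨fun t => f (l - t), l, hl, by fun_prop, ?_, by simpa, by simpa, ?_⟩
  · intro s hs t ht hst
    have := hi (x₁ := l - s) (x₂ := l - t) ⟨by linarith [hs.2], by linarith [hs.1]⟩
      ⟨by linarith [ht.2], by linarith [ht.1]⟩ hst
    linarith
  · intro t ht
    exact hS _ ⟨by linarith [ht.2], by linarith [ht.1]⟩

theorem exists_first_mem {f : ℝ → X} {a b c : ℝ} {P : Set X} (hP : IsClosed P)
    (hf : ContinuousOn f (Set.Icc a b)) (hc : c ∈ Set.Icc a b) (hcP : f c ∈ P) :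
    ∃ t ∈ Set.Icc a b, t ≤ c ∧ f t ∈ P ∧ ∀ t' ∈ Set.Icc a b, f t' ∈ P → t ≤ t' := by
  have h1 : IsCompact (Set.Icc a b ∩ f ⁻¹' P) :=
    isCompact_Icc.of_isClosed_subset (hf.preimage_isClosed_of_isClosed isClosed_Icc hP)
      Set.inter_subset_left
  obtain ⟨t, ht, hmin⟩ := h1.exists_isLeast ⟨c, hc, hcP⟩
  exact ⟨t, ht.1, hmin ⟨hc, hcP⟩, ht.2, fun t' h h' => hmin ⟨h, h'⟩⟩

theorem exists_last_mem {f : ℝ → X} {a b c : ℝ} {P : Set X} (hP : IsClosed P)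
    (hf : ContinuousOn f (Set.Icc a b)) (hc : c ∈ Set.Icc a b) (hcP : f c ∈ P) :
    ∃ t ∈ Set.Icc a b, c ≤ t ∧ f t ∈ P ∧ ∀ t' ∈ Set.Icc a b, f t' ∈ P → t' ≤ t := by
  have h1 : IsCompact (Set.Icc a b ∩ f ⁻¹' P) :=
    isCompact_Icc.of_isClosed_subset (hf.preimage_isClosed_of_isClosed isClosed_Icc hP)
      Set.inter_subset_left
  obtain ⟨t, ht, hmax⟩ := h1.exists_isGreatest ⟨c, hc, hcP⟩
  exact ⟨t, ht.1, hmax ⟨hc, hcP⟩, ht.2, fun t' h h' => hmax ⟨h, h'⟩⟩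

theorem ArcIn.trans {S : Set X} {a b c : X} (h : ArcIn S a b) (h' : ArcIn S b c) :
    ArcIn S a c := by
  obtain ⟨f, l, hl, hc, hi, h0, h1, hS⟩ := h
  obtain ⟨g, k, hk, hc', hi', h0', h1', hS'⟩ := h'
  have hcl : IsClosed (g '' Set.Icc 0 k) := (isCompact_Icc.image hc').isClosed
  obtain ⟨t, ht, -, ⟨u, hu, hut⟩, hmin⟩ := exists_first_mem hcl hc.continuousOn
    (c := l) ⟨hl, le_rfl⟩ ⟨0, ⟨le_rfl, hk⟩, by rw [h0', h1]⟩
  refine ⟨fun s => if s ≤ t then f s else g (s - t + u), t + (k - u), by linarith [ht.1, hu.2],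
    ?_, ?_, ?_, ?_, ?_⟩
  · refine Continuous.if_le hc (by fun_prop) continuous_id continuous_const ?_
    rintro x rfl
    simp [hut]
  · intro p hp q hq hpq
    have key : ∀ p ∈ Set.Icc 0 (t + (k - u)), ∀ q ∈ Set.Icc 0 (t + (k - u)), p ≤ t → t < q →
        f p = g (q - t + u) → False := by
      intro p hp q hq hpt hqt hpq
      have hqk : q - t + u ∈ Set.Icc 0 k := ⟨by linarith [hu.1], by linarith [hq.2]⟩
      have h2 := hmin p ⟨hp.1, hpt.trans ht.2⟩ ⟨_, hqk, hpq.symm⟩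
      have h3 : p = t := le_antisymm hpt h2
      rw [h3, ← hut] at hpq
      have := hi' hu hqk hpq
      linarith
    dsimp only at hpq
    split_ifs at hpq with hpt hqt hqt
    · exact hi ⟨hp.1, hpt.trans ht.2⟩ ⟨hq.1, hqt.trans ht.2⟩ hpq
    · exact (key p hp q hq hpt (not_le.1 hqt) hpq).elim
    · exact (key q hq p hp hqt (not_le.1 hpt) hpq.symm).elim
    · push Not at hpt hqt
      have := hi' (x₁ := p - t + u) (x₂ := q - t + u) ⟨by linarith [hu.1], by linarith [hp.2]⟩
        ⟨by linarith [hu.1], by linarith [hq.2]⟩ hpq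
      linarith
  · simp [ht.1, h0]
  · dsimp only
    split_ifs with h
    · have hku : u = k := by linarith [hu.2]
      rw [hku]
      simp only [sub_self, add_zero]
      rw [← hut, hku, h1']
    · rw [show t + (k - u) - t + u = k by ring, h1']
  · intro s hs
    dsimp only
    split_ifs with h
    · exact hS _ ⟨hs.1, h.trans ht.2⟩
    · exact hS' _ ⟨by linarith [hu.1], by linarith [hs.2]⟩

theorem IsGeodesicSegment.mono {γ : ℝ → X} {a b a' b' : ℝ} (h : IsGeodesicSegment γ a b)
    (ha : a ≤ a') (hb : b' ≤ b) : IsGeodesicSegment γ a' b' := fun s hs t ht =>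
  h s ⟨ha.trans hs.1, hs.2.trans hb⟩ t ⟨ha.trans ht.1, ht.2.trans hb⟩

theorem IsGeodesicSegment.injOn {γ : ℝ → X} {a b : ℝ} (h : IsGeodesicSegment γ a b) :
    Set.InjOn γ (Set.Icc a b) := by
  intro s hs t ht hst
  have := h s hs t ht
  rw [hst, dist_self] at this
  linarith [abs_eq_zero.1 this.symm]

theorem IsGeodesicSegment.continuousOn {γ : ℝ → X} {a b : ℝ} (h : IsGeodesicSegment γ a b) :
    ContinuousOn γ (Set.Icc a b) := by
  have : LipschitzOnWith 1 γ (Set.Icc a b) :=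
    LipschitzOnWith.of_dist_le_mul fun s hs t ht => by
      rw [h s hs t ht, Real.dist_eq]; simp
  exact this.continuousOn

theorem IsGeodesicSegment.exists_continuous {γ : ℝ → X} {a b : ℝ} (hab : a ≤ b)
    (h : IsGeodesicSegment γ a b) :
    ∃ f : ℝ → X, Continuous f ∧ Set.EqOn f γ (Set.Icc a b) := by
  refine ⟨Set.IccExtend hab ((Set.Icc a b).domRestrict γ), ?_, ?_⟩
  · exact (continuousOn_iff_continuous_domRestrict.1 h.continuousOn).Icc_extend'
  · intro t ht
    rw [Set.IccExtend_of_mem hab _ ht]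
    rfl

theorem IsGeodesicSegment.arcIn {S : Set X} {γ : ℝ → X} {a b : ℝ} (hab : a ≤ b)
    (h : IsGeodesicSegment γ a b) (hS : ∀ t ∈ Set.Icc a b, γ t ∈ S) :
    ArcIn S (γ a) (γ b) := by
  obtain ⟨f, hf, hfe⟩ := h.exists_continuous hab
  rw [← hfe ⟨le_rfl, hab⟩, ← hfe ⟨hab, le_rfl⟩]
  exact arcIn_of_subinterval hab hf (h.injOn.congr hfe.symm) fun t ht => hfe ht ▸ hS t ht

/-- Two arcs with common endpoints and otherwise disjoint lie in a common piece. -/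
theorem IsTreeGraded.exists_piece_of_two_arcs {PX : Set (Set X)} (hT : IsTreeGraded X PX)
    {f g : ℝ → X} {l k : ℝ} (hl : 0 < l) (hk : 0 < k) (hf : Continuous f) (hg : Continuous g)
    (hfi : Set.InjOn f (Set.Icc 0 l)) (hgi : Set.InjOn g (Set.Icc 0 k))
    (h0 : f 0 = g 0) (h1 : f l = g k)
    (hd : ∀ s ∈ Set.Icc 0 l, ∀ t ∈ Set.Icc 0 k, f s = g t → (s = 0 ∧ t = 0) ∨ (s = l ∧ t = k)) :
    ∃ Q ∈ PX, (∀ t ∈ Set.Icc 0 l, f t ∈ Q) ∧ ∀ t ∈ Set.Icc 0 k, g t ∈ Q := by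
  set h : ℝ → X := fun t => if t ≤ 1 / 2 then f (2 * l * t) else g (k * (2 - 2 * t)) with hh
  have hc : Continuous h := by
    refine Continuous.if_le (by fun_prop) (by fun_prop) continuous_id continuous_const ?_
    rintro x rfl
    rw [show 2 * l * (1 / 2) = l by ring, show k * (2 - 2 * (1 / 2)) = k by ring, h1]
  have hinj : Set.InjOn h (Set.Ico 0 1) := by
    have key : ∀ p ∈ Set.Ico (0 : ℝ) 1, ∀ q ∈ Set.Ico (0 : ℝ) 1, p ≤ 1 / 2 → 1 / 2 < q →
        f (2 * l * p) = g (k * (2 - 2 * q)) → False := by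
      intro p hp q hq hp' hq' hpq
      have hp1 : 0 ≤ 2 * l * p := by have := hp.1; positivity
      have hq1 : 0 < k * (2 - 2 * q) := mul_pos hk (by linarith [hq.2])
      have hq2 : k * (2 - 2 * q) < k := by nlinarith
      rcases hd _ ⟨hp1, by nlinarith⟩ _ ⟨hq1.le, hq2.le⟩ hpq with h | h
      · linarith [h.2]
      · linarith [h.2]
    intro p hp q hq hpq
    simp only [hh] at hpq
    split_ifs at hpq with h1 h2 h2
    · have := hfi (x₁ := 2 * l * p) (x₂ := 2 * l * q)
        ⟨by have := hp.1; positivity, by nlinarith⟩ ⟨by have := hq.1; positivity, by nlinarith⟩ hpq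
      exact mul_left_cancel₀ (by positivity) this
    · exact (key p hp q hq h1 (not_le.1 h2) hpq).elim
    · exact (key q hq p hp h2 (not_le.1 h1) hpq.symm).elim
    · push Not at h1 h2
      have := hgi (x₁ := k * (2 - 2 * p)) (x₂ := k * (2 - 2 * q))
        ⟨mul_nonneg hk.le (by linarith [hp.2]), by nlinarith⟩
        ⟨mul_nonneg hk.le (by linarith [hq.2]), by nlinarith⟩ hpq
      have := mul_left_cancel₀ hk.ne' this
      linarith
  have : Fact ((0 : ℝ) < 1) := ⟨one_pos⟩
  have hh01 : h 0 = h (0 + 1) := by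
    simp only [hh]
    norm_num
    exact h0
  obtain ⟨Q, hQ, hsub⟩ := hT.t2 (AddCircle.liftIco (1 : ℝ) 0 h)
    (AddCircle.liftIco_continuous hh01 hc.continuousOn) (by
      intro p q hpq
      obtain ⟨p', hp', rfl⟩ : ∃ p' ∈ Set.Ico (0 : ℝ) (0 + 1), (p' : AddCircle (1 : ℝ)) = p := by
        have := AddCircle.coe_image_Ico_eq (1 : ℝ) 0
        have h2 : p ∈ (Set.univ : Set (AddCircle (1 : ℝ))) := trivial
        rw [← this] at h2
        exact h2
      obtain ⟨q', hq', rfl⟩ : ∃ p' ∈ Set.Ico (0 : ℝ) (0 + 1), (p' : AddCircle (1 : ℝ)) = q := by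
        have := AddCircle.coe_image_Ico_eq (1 : ℝ) 0
        have h2 : q ∈ (Set.univ : Set (AddCircle (1 : ℝ))) := trivial
        rw [← this] at h2
        exact h2
      rw [AddCircle.liftIco_coe_apply hp', AddCircle.liftIco_coe_apply hq'] at hpq
      rw [zero_add] at hp' hq'
      rw [hinj hp' hq' hpq])
  have hmem : ∀ t ∈ Set.Icc (0 : ℝ) 1, h t ∈ Q := by
    have h2 : ∀ t ∈ Set.Ico (0 : ℝ) 1, h t ∈ Q := by
      intro t ht
      apply hsub
      refine ⟨(t : AddCircle (1 : ℝ)), AddCircle.liftIco_coe_apply (by simpa using ht)⟩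
    intro t ht
    rcases eq_or_lt_of_le ht.2 with h3 | h3
    · rw [h3, ← zero_add (1 : ℝ), ← hh01]
      exact h2 0 ⟨le_rfl, one_pos⟩
    · exact h2 t ⟨ht.1, h3⟩
  refine ⟨Q, hQ, fun t ht => ?_, fun t ht => ?_⟩
  · have h2 : t / (2 * l) ≤ 1 / 2 := by
      rw [div_le_iff₀ (by positivity)]; linarith [ht.2]
    have := hmem (t / (2 * l)) ⟨by have := ht.1; positivity, by linarith⟩
    simp only [hh, if_pos h2] at this
    rwa [mul_div_cancel₀ _ (by positivity)] at this
  · rcases eq_or_lt_of_le ht.2 with h3 | h3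
    · have := hmem (1 / 2) ⟨by norm_num, by norm_num⟩
      simp only [hh, if_pos le_rfl] at this
      rwa [show 2 * l * (1 / 2) = l by ring, h1, ← h3] at this
    · have h2 : ¬ (1 - t / (2 * k) ≤ 1 / 2) := by
        have : t / (2 * k) < 1 / 2 := by
          rw [div_lt_iff₀ (by positivity)]; linarith
        linarith
      have h4 : 0 ≤ t / (2 * k) := by have := ht.1; positivity
      have := hmem (1 - t / (2 * k)) ⟨by linarith, by linarith⟩
      simp only [hh, if_neg h2] at this
      rwa [show k * (2 - 2 * (1 - t / (2 * k))) = t by field_simp; ring] at this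

end Arcs

section Crossing

variable {X : Type*}

/-- The geodesic `γ : [0, L] → X` meets `P` exactly in the parameter interval `[s, e]`. -/
def Crosses (γ : ℝ → X) (L : ℝ) (P : Set X) (s e : ℝ) : Prop :=
  0 ≤ s ∧ s ≤ e ∧ e ≤ L ∧ ∀ t ∈ Set.Icc 0 L, γ t ∈ P ↔ s ≤ t ∧ t ≤ e

theorem Crosses.start_mem {γ : ℝ → X} {L s e : ℝ} {P : Set X} (h : Crosses γ L P s e) :
    γ s ∈ P := (h.2.2.2 s ⟨h.1, h.2.1.trans h.2.2.1⟩).2 ⟨le_rfl, h.2.1⟩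

theorem Crosses.end_mem {γ : ℝ → X} {L s e : ℝ} {P : Set X} (h : Crosses γ L P s e) :
    γ e ∈ P := (h.2.2.2 e ⟨h.1.trans h.2.1, h.2.2.1⟩).2 ⟨h.2.1, le_rfl⟩

theorem Crosses.mem {γ : ℝ → X} {L s e t : ℝ} {P : Set X} (h : Crosses γ L P s e)
    (hst : s ≤ t) (hte : t ≤ e) : γ t ∈ P :=
  (h.2.2.2 t ⟨h.1.trans hst, hte.trans h.2.2.1⟩).2 ⟨hst, hte⟩

theorem Crosses.setOf_eq {γ : ℝ → X} {L s e : ℝ} {P : Set X} (h : Crosses γ L P s e) :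
    {t | t ∈ Set.Icc 0 L ∧ γ t ∈ P} = Set.Icc s e := by
  ext t
  constructor
  · rintro ⟨ht, htP⟩
    exact (h.2.2.2 t ht).1 htP
  · intro ht
    exact ⟨⟨h.1.trans ht.1, ht.2.trans h.2.2.1⟩, h.mem ht.1 ht.2⟩

theorem Crosses.pieceStart_eq {γ : ℝ → X} {L s e : ℝ} {P : Set X} (h : Crosses γ L P s e) :
    pieceStart γ L P = s := by
  rw [pieceStart, h.setOf_eq, csInf_Icc h.2.1]

theorem Crosses.pieceEnd_eq {γ : ℝ → X} {L s e : ℝ} {P : Set X} (h : Crosses γ L P s e) :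
    pieceEnd γ L P = e := by
  rw [pieceEnd, h.setOf_eq, csSup_Icc h.2.1]

theorem Crosses.unique {γ : ℝ → X} {L s e s' e' : ℝ} {P : Set X} (h : Crosses γ L P s e)
    (h' : Crosses γ L P s' e') : s = s' ∧ e = e' :=
  ⟨h.pieceStart_eq.symm.trans h'.pieceStart_eq, h.pieceEnd_eq.symm.trans h'.pieceEnd_eq⟩

end Crossing

section Projections

variable {X : Type*} [MetricSpace X] {PX : Set (Set X)} {n : ℕ} {r fr : ℝ} {xhat : X}
  {proj : Set X → X → X} {cP : Set X → X → Fin (n + 1)}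

theorem IsTreeGraded.not_arcIn_excursion (hT : IsTreeGraded X PX) {P : Set X} (hP : P ∈ PX)
    {p q : X} (hp : p ∈ P) (hq : q ∈ P) (hpq : p ≠ q) : ¬ ArcIn (Pᶜ ∪ {p, q}) p q := by
  rintro ⟨f, l, hl, hc, hi, h0, h1, hS⟩
  have hl' : 0 < l := by
    rcases eq_or_lt_of_le hl with h | h
    · exact (hpq (by rw [← h0, ← h1, ← h])).elim
    · exact h
  obtain ⟨σ, hσ, hσ0, hσ1, hσP⟩ := hT.geodesicSub P hP p hp q hq
  have hd : 0 < dist p q := dist_pos.2 hpq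
  obtain ⟨g, hg, hge⟩ := hσ.exists_continuous hd.le
  have hg0 : g 0 = p := by rw [hge ⟨le_rfl, hd.le⟩, hσ0]
  have hg1 : g (dist p q) = q := by rw [hge ⟨hd.le, le_rfl⟩, hσ1]
  have hgi : Set.InjOn g (Set.Icc 0 (dist p q)) := hσ.injOn.congr hge.symm
  have hend : ∀ s ∈ Set.Icc 0 l, f s ∈ P → s = 0 ∨ s = l := by
    intro s hs hsP
    rcases hS s hs with h | h | h
    · exact (h hsP).elim
    · exact Or.inl (hi hs ⟨le_rfl, hl⟩ (h.trans h0.symm))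
    · exact Or.inr (hi hs ⟨hl, le_rfl⟩ (Eq.trans h h1.symm))
  obtain ⟨Q, hQ, hfQ, -⟩ := hT.exists_piece_of_two_arcs hl' hd hc hg hi hgi
    (h0.trans hg0.symm) (h1.trans hg1.symm) (by
      intro s hs t ht hst
      rcases hend s hs (by rw [hst, hge ht]; exact hσP t ht) with h | h
      · exact Or.inl ⟨h, hgi ht ⟨le_rfl, hd.le⟩ (by rw [← hst, h, h0, hg0])⟩
      · exact Or.inr ⟨h, hgi ht ⟨hd.le, le_rfl⟩ (by rw [← hst, h, h1, hg1])⟩)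
  have hQP : Q = P := by
    by_contra hne
    exact hpq (hT.t1 Q hQ P hP hne ⟨h0 ▸ hfQ 0 ⟨le_rfl, hl⟩, hp⟩ ⟨h1 ▸ hfQ l ⟨hl, le_rfl⟩, hq⟩)
  rcases hend (l / 2) ⟨by linarith, by linarith⟩
    (hQP ▸ hfQ _ ⟨by linarith, by linarith⟩) with h | h <;> linarith

namespace ColoringSetup

theorem arcIn_proj (h : ColoringSetup X PX n r fr xhat proj cP) {P : Set X} (hP : P ∈ PX)
    (x : X) : ArcIn (Pᶜ ∪ {proj P x}) x (proj P x) := by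
  obtain ⟨σ, hσ, hσ0, hσ1⟩ := h.geodesic x (proj P x)
  have key := hσ.arcIn (S := Pᶜ ∪ {proj P x}) dist_nonneg fun t ht => by
    rcases eq_or_lt_of_le ht.2 with ht' | ht'
    · exact Or.inr (by rw [ht', hσ1]; rfl)
    · refine Or.inl fun htP => ?_
      have h1 := hσ 0 ⟨le_rfl, dist_nonneg⟩ t ht
      rw [hσ0, zero_sub, abs_neg, abs_of_nonneg ht.1] at h1
      have h2 := Metric.infDist_le_dist_of_mem (x := x) htP
      rw [← h.projDist P hP x, h1] at h2
      linarith
  rwa [hσ0, hσ1] at key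

theorem eq_proj_of_arcIn (h : ColoringSetup X PX n r fr xhat proj cP) {P : Set X} (hP : P ∈ PX)
    {z x : X} (hz : z ∈ P) (harc : ArcIn (Pᶜ ∪ {z}) z x) : proj P x = z := by
  by_contra hne
  refine h.treeGraded.not_arcIn_excursion hP hz (h.projMem P hP x) (Ne.symm hne) ?_
  refine (harc.mono (T := Pᶜ ∪ {z, proj P x}) ?_).trans ((h.arcIn_proj hP x).mono ?_)
  · exact Set.union_subset_union_right _ (by simp)
  · exact Set.union_subset_union_right _ (by simp)

theorem proj_eq_of_arcIn_compl (h : ColoringSetup X PX n r fr xhat proj cP) {P : Set X}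
    (hP : P ∈ PX) {y z : X} (harc : ArcIn Pᶜ y z) : proj P z = proj P y :=
  h.eq_proj_of_arcIn hP (h.projMem P hP y)
    ((h.arcIn_proj hP y).symm.trans (harc.mono Set.subset_union_left))

end ColoringSetup

/-- Pieces are convex. -/
theorem IsTreeGraded.mem_of_mem_of_mem (hT : IsTreeGraded X PX) {P : Set X} (hP : P ∈ PX)
    {γ : ℝ → X} {a b : ℝ} (hγ : IsGeodesicSegment γ a b) {s t u : ℝ} (has : a ≤ s) (hst : s ≤ t)
    (htu : t ≤ u) (hub : u ≤ b) (hs : γ s ∈ P) (hu : γ u ∈ P) : γ t ∈ P := by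
  by_contra htP
  have hγ' := hγ.mono has hub
  obtain ⟨p, hp, -, hpP, hpmax⟩ := exists_last_mem (hT.closed P hP)
    (hγ'.mono le_rfl htu).continuousOn (c := s) ⟨le_rfl, hst⟩ hs
  obtain ⟨q, hq, -, hqP, hqmin⟩ := exists_first_mem (hT.closed P hP)
    (hγ'.mono hst le_rfl).continuousOn (c := u) ⟨htu, le_rfl⟩ hu
  have hpt : p < t := lt_of_le_of_ne hp.2 fun h => htP (h ▸ hpP)
  have htq : t < q := lt_of_le_of_ne hq.1 fun h => htP (h ▸ hqP)
  have hne : γ p ≠ γ q := fun he =>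
    absurd (hγ'.injOn ⟨hp.1, hp.2.trans htu⟩ ⟨hst.trans hq.1, hq.2⟩ he) (by linarith)
  refine hT.not_arcIn_excursion hP hpP hqP hne ?_
  refine (hγ'.mono hp.1 hq.2).arcIn (by linarith) fun v hv => ?_
  by_cases hvP : γ v ∈ P
  · right
    rcases le_total v t with hvt | hvt
    · have := hpmax v ⟨hp.1.trans hv.1, hvt⟩ hvP
      exact Or.inl (by rw [le_antisymm this hv.1])
    · have := hqmin v ⟨hvt, hv.2.trans hq.2⟩ hvP
      exact Or.inr (by rw [le_antisymm hv.2 this]; rfl)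
  · exact Or.inl hvP

theorem IsTreeGraded.exists_crosses (hT : IsTreeGraded X PX) {P : Set X} (hP : P ∈ PX)
    {γ : ℝ → X} {L : ℝ} (hγ : IsGeodesicSegment γ 0 L) {t : ℝ} (ht : t ∈ Set.Icc 0 L)
    (htP : γ t ∈ P) : ∃ s e, Crosses γ L P s e := by
  obtain ⟨s, hs, hst, hsP, hsmin⟩ := exists_first_mem (hT.closed P hP) hγ.continuousOn ht htP
  obtain ⟨e, he, hte, heP, hemax⟩ := exists_last_mem (hT.closed P hP) hγ.continuousOn ht htP
  refine ⟨s, e, hs.1, hst.trans hte, he.2, fun u hu => ⟨fun huP => ⟨hsmin u hu huP,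
    hemax u hu huP⟩, fun hue => ?_⟩⟩
  exact hT.mem_of_mem_of_mem hP hγ hs.1 hue.1 hue.2 he.2 hsP heP

namespace ColoringSetup

theorem proj_end_eq (h : ColoringSetup X PX n r fr xhat proj cP)
    {γ : ℝ → X} {L : ℝ} (hγ : IsGeodesicSegment γ 0 L) {P : Set X} (hP : P ∈ PX)
    {s e : ℝ} (hc : Crosses γ L P s e) : proj P (γ L) = γ e := by
  refine h.eq_proj_of_arcIn hP hc.end_mem ?_
  refine (hγ.mono (hc.1.trans hc.2.1) le_rfl).arcIn hc.2.2.1 fun t ht => ?_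
  by_cases htP : γ t ∈ P
  · right
    have := ((hc.2.2.2 t ⟨(hc.1.trans hc.2.1).trans ht.1, ht.2⟩).1 htP).2
    rw [le_antisymm this ht.1]; rfl
  · exact Or.inl htP

theorem proj_start_eq (h : ColoringSetup X PX n r fr xhat proj cP)
    {γ : ℝ → X} {L : ℝ} (hγ : IsGeodesicSegment γ 0 L) {P : Set X}
    (hP : P ∈ PX) {s e : ℝ} (hc : Crosses γ L P s e) : proj P (γ 0) = γ s := by
  refine h.eq_proj_of_arcIn hP hc.start_mem (ArcIn.symm ?_)
  refine (hγ.mono le_rfl (hc.2.1.trans hc.2.2.1)).arcIn hc.1 fun t ht => ?_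
  by_cases htP : γ t ∈ P
  · right
    have := ((hc.2.2.2 t ⟨ht.1, ht.2.trans (hc.2.1.trans hc.2.2.1)⟩).1 htP).1
    rw [le_antisymm ht.2 this]; rfl
  · exact Or.inl htP

theorem proj_eq_of_not_meet (h : ColoringSetup X PX n r fr xhat proj cP)
    {γ : ℝ → X} {L : ℝ} (hL : 0 ≤ L) (hγ : IsGeodesicSegment γ 0 L)
    {P : Set X} (hP : P ∈ PX) (hm : ∀ t ∈ Set.Icc 0 L, γ t ∉ P) :
    proj P (γ L) = proj P (γ 0) :=
  h.proj_eq_of_arcIn_compl hP (hγ.arcIn hL hm)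

theorem proj_of_mem (h : ColoringSetup X PX n r fr xhat proj cP)
    {P : Set X} (hP : P ∈ PX) {y : X} (hy : y ∈ P) : proj P y = y :=
  h.eq_proj_of_arcIn hP hy (ArcIn.refl (Or.inr rfl))

/-- A geodesic joining two points with different projections to a piece passes through
both projections. -/
theorem crosses_of_proj_ne (h : ColoringSetup X PX n r fr xhat proj cP)
    {γ : ℝ → X} {L : ℝ} (hL : 0 ≤ L) (hγ : IsGeodesicSegment γ 0 L)
    {P : Set X} (hP : P ∈ PX) (hne : proj P (γ L) ≠ proj P (γ 0)) :
    ∃ s e, Crosses γ L P s e ∧ γ s = proj P (γ 0) ∧ γ e = proj P (γ L) := by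
  by_cases hm : ∃ t ∈ Set.Icc 0 L, γ t ∈ P
  · obtain ⟨t, ht, htP⟩ := hm
    obtain ⟨s, e, hc⟩ := h.treeGraded.exists_crosses hP hγ ht htP
    exact ⟨s, e, hc, (h.proj_start_eq hγ hP hc).symm, (h.proj_end_eq hγ hP hc).symm⟩
  · push Not at hm
    exact (hne (h.proj_eq_of_not_meet hL hγ hP hm)).elim

theorem dist_eq_of_proj_ne (h : ColoringSetup X PX n r fr xhat proj cP)
    {P : Set X} (hP : P ∈ PX) {y z : X} (hne : proj P z ≠ proj P y) :
    dist y z = dist y (proj P y) + dist (proj P y) (proj P z) + dist (proj P z) z := by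
  obtain ⟨σ, hσ, hσ0, hσ1⟩ := h.geodesic y z
  obtain ⟨s, e, hc, hs, he⟩ := h.crosses_of_proj_ne dist_nonneg hσ hP (by rwa [hσ0, hσ1])
  have h0 := hc.1
  have h1 := hc.2.1
  have h2 := hc.2.2.1
  have e1 := hσ 0 ⟨le_rfl, dist_nonneg⟩ s ⟨h0, h1.trans h2⟩
  have e2 := hσ s ⟨h0, h1.trans h2⟩ e ⟨h0.trans h1, h2⟩
  have e3 := hσ e ⟨h0.trans h1, h2⟩ _ ⟨dist_nonneg, le_rfl⟩
  rw [hs, hσ0] at e1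
  rw [hs, hσ0, he, hσ1] at e2
  rw [he, hσ1] at e3
  rw [e1, e2, e3, abs_of_nonpos (by linarith), abs_of_nonpos (by linarith),
    abs_of_nonpos (by linarith)]
  ring

end ColoringSetup

end Projections

section MaximalIntervals

/-- The maximal compact intervals contained in `B`, as pairs of endpoints. -/
def maxIntervals (B : Set ℝ) : Set (ℝ × ℝ) :=
  {p | p.1 ≤ p.2 ∧ Set.Icc p.1 p.2 ⊆ B ∧
    ∀ a b, a ≤ p.1 → p.2 ≤ b → Set.Icc a b ⊆ B → a = p.1 ∧ b = p.2}

theorem maxIntervals_iUnion_Icc {k : ℕ} {a b : Fin k → ℝ} (hab : ∀ i, a i ≤ b i)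
    (hsep : ∀ i j, i ≠ j → b i < a j ∨ b j < a i) :
    maxIntervals (⋃ i, Set.Icc (a i) (b i)) = Set.range fun i => (a i, b i) := by
  have key : ∀ i c d, (Set.Icc c d ∩ Set.Icc (a i) (b i)).Nonempty →
      Set.Icc c d ⊆ ⋃ i, Set.Icc (a i) (b i) → Set.Icc c d ⊆ Set.Icc (a i) (b i) := by
    intro i c d hne hsub
    have hpre : IsPreconnected (Set.Icc c d) := isPreconnected_Icc
    have hcl : IsClosed (⋃ j ∈ {j | j ≠ i}, Set.Icc (a j) (b j)) :=
      (Set.toFinite _).isClosed_biUnion fun _ _ => isClosed_Icc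
    have hdisj : Set.Icc (a i) (b i) ∩ (⋃ j ∈ {j | j ≠ i}, Set.Icc (a j) (b j)) = ∅ := by
      rw [Set.eq_empty_iff_forall_notMem]
      rintro t ⟨ht, ht'⟩
      simp only [Set.mem_iUnion, Set.mem_ofPred_eq] at ht'
      obtain ⟨j, hj, htj⟩ := ht'
      rcases hsep j i hj with h | h
      · linarith [htj.2, ht.1]
      · linarith [htj.1, ht.2]
    rcases isPreconnected_iff_subset_of_disjoint_closed.1 hpre _ _ isClosed_Icc hcl
      (by
        intro t ht
        obtain ⟨j, hj⟩ := Set.mem_iUnion.1 (hsub ht)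
        by_cases hji : j = i
        · exact Or.inl (hji ▸ hj)
        · exact Or.inr (Set.mem_biUnion (show j ∈ {j | j ≠ i} from hji) hj))
      (by rw [hdisj, Set.inter_empty]) with h | h
    · exact h
    · obtain ⟨t, ht, ht'⟩ := hne
      have : t ∈ (∅ : Set ℝ) := hdisj ▸ ⟨ht', h ht⟩
      exact this.elim
  ext ⟨c, d⟩
  constructor
  · rintro ⟨hcd, hsub, hmax⟩
    obtain ⟨i, hi⟩ := Set.mem_iUnion.1 (hsub ⟨le_rfl, hcd⟩)
    have h1 := key i c d ⟨c, ⟨le_rfl, hcd⟩, hi⟩ hsub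
    have h2 := h1 ⟨hcd, le_rfl⟩
    obtain ⟨h3, h4⟩ := hmax (a i) (b i) hi.1 h2.2
      (Set.subset_iUnion (fun i => Set.Icc (a i) (b i)) i)
    exact ⟨i, Prod.ext h3 h4⟩
  · rintro ⟨i, hi⟩
    obtain ⟨rfl, rfl⟩ := Prod.mk.inj hi
    refine ⟨hab i, Set.subset_iUnion (fun i => Set.Icc (a i) (b i)) i, ?_⟩
    intro c d hc hd hsub
    have hc : c ≤ a i := hc
    have hd : b i ≤ d := hd
    have hi' := hab i
    have h1 := key i c d ⟨a i, ⟨hc, hi'.trans hd⟩, ⟨le_rfl, hi'⟩⟩ hsub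
    have h2 := h1 ⟨le_rfl, by linarith⟩
    have h3 := h1 ⟨show c ≤ d by linarith, le_rfl⟩
    exact ⟨le_antisymm hc h2.1, le_antisymm h3.2 hd⟩

theorem maxIntervals_union_Icc {B : Set ℝ} {m p q : ℝ} (hB : ∀ t ∈ B, t ≤ m) (hm : m < p)
    (hpq : p ≤ q) : maxIntervals (B ∪ Set.Icc p q) = insert (p, q) (maxIntervals B) := by
  have key : ∀ c d, c ≤ d → Set.Icc c d ⊆ B ∪ Set.Icc p q →
      Set.Icc c d ⊆ B ∨ Set.Icc c d ⊆ Set.Icc p q := by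
    intro c d hcd hsub
    rcases hsub ⟨le_rfl, hcd⟩ with hc | hc <;> rcases hsub ⟨hcd, le_rfl⟩ with hd | hd
    · left
      intro t ht
      rcases hsub ht with h | h
      · exact h
      · linarith [hB d hd, ht.2, h.1]
    · have hcm := hB c hc
      exfalso
      rcases hsub (show (m + p) / 2 ∈ Set.Icc c d from ⟨by linarith, by linarith [hd.1]⟩) with h | h
      · linarith [hB _ h]
      · linarith [h.1]
    · linarith [hB d hd, hc.1]
    · exact Or.inr fun t ht => ⟨hc.1.trans ht.1, ht.2.trans hd.2⟩
  ext ⟨c, d⟩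
  constructor
  · rintro ⟨hcd, hsub, hmax⟩
    rcases key c d hcd hsub with h | h
    · exact Or.inr ⟨hcd, h, fun a b ha hb hab => hmax a b ha hb (hab.trans Set.subset_union_left)⟩
    · left
      obtain ⟨h1, h2⟩ := hmax p q (h ⟨le_rfl, hcd⟩).1 (h ⟨hcd, le_rfl⟩).2 Set.subset_union_right
      simp only at h1 h2
      rw [h1, h2]
  · rintro (h | ⟨hcd, hsub, hmax⟩)
    · obtain ⟨rfl, rfl⟩ := Prod.mk.inj h
      refine ⟨hpq, Set.subset_union_right, fun a b ha hb hab => ?_⟩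
      have ha : a ≤ c := ha
      have hb : d ≤ b := hb
      rcases key a b (by linarith) hab with h | h
      · linarith [hB c (h ⟨ha, hpq.trans hb⟩)]
      · have h1 := h ⟨le_rfl, by linarith⟩
        have h2 := h ⟨show a ≤ b by linarith, le_rfl⟩
        exact ⟨le_antisymm ha h1.1, le_antisymm h2.2 hb⟩
    · refine ⟨hcd, hsub.trans Set.subset_union_left, fun a b ha hb hab => ?_⟩
      have hcd : c ≤ d := hcd
      have ha' : a ≤ c := ha
      have hb' : d ≤ b := hb
      rcases key a b (by linarith) hab with h | h
      · exact hmax a b ha hb h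
      · have h1 := (h (show c ∈ Set.Icc a b from ⟨ha', by linarith⟩)).1
        linarith [hB c (hsub ⟨le_rfl, hcd⟩)]

end MaximalIntervals

section ColorFormula

variable {X : Type*} {PX : Set (Set X)} {n : ℕ} {r fr : ℝ} {xhat : X}
  {proj : Set X → X → X} {cP : Set X → X → Fin (n + 1)}

theorem floorLen_le_of_mem {γ : ℝ → X} {a b t : ℝ} (ht : t ∈ Set.Icc a b)
    {P : Set X} (hP : P ∈ PX) (hsub : γ '' Set.Icc t b ⊆ P) : floorLen PX γ a b ≤ t - a := by
  have : t ∈ {t | t ∈ Set.Icc a b ∧ ∃ P ∈ PX, γ '' Set.Icc t b ⊆ P} := ⟨ht, P, hP, hsub⟩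
  have := csInf_le (a := t) ⟨a, fun t ht => ht.1.1⟩ this
  unfold floorLen
  linarith

/-- The contribution to the color of the floored lengths of the maximal intervals of `B`. -/
noncomputable def floorSum (PX : Set (Set X)) (fr : ℝ) (n : ℕ) (γ : ℝ → X) (B : Set ℝ) :
    ZMod (n + 1) :=
  ∑ᶠ p ∈ maxIntervals B, (⌊floorLen PX γ p.1 p.2 / (99 * fr)⌋₊ : ZMod (n + 1))

/-- The contribution to the color of `y` of the colorings of the pieces. -/
noncomputable def pieceSum (PX : Set (Set X)) (proj : Set X → X → X)
    (cP : Set X → X → Fin (n + 1)) (y : X) : ZMod (n + 1) :=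
  ∑ᶠ P ∈ PX, ((cP P (proj P y) : ℕ) : ZMod (n + 1))

theorem floorSum_union_Icc {γ : ℝ → X} {B : Set ℝ} {m p q : ℝ} (hfin : (maxIntervals B).Finite)
    (hB : ∀ t ∈ B, t ≤ m) (hm : m < p) (hpq : p ≤ q) :
    floorSum PX fr n γ (B ∪ Set.Icc p q) =
      floorSum PX fr n γ B + (⌊floorLen PX γ p q / (99 * fr)⌋₊ : ZMod (n + 1)) := by
  have hnot : (p, q) ∉ maxIntervals B := fun h => by
    linarith [hB p (h.2.1 ⟨le_rfl, h.1⟩)]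
  rw [floorSum, maxIntervals_union_Icc hB hm hpq, finsum_mem_insert _ hnot hfin]
  exact add_comm _ _

theorem ZMod.natCast_fin_inj {i j : Fin (n + 1)}
    (h : ((i : ℕ) : ZMod (n + 1)) = ((j : ℕ) : ZMod (n + 1))) : i = j := by
  rw [ZMod.natCast_eq_natCast_iff, Nat.ModEq, Nat.mod_eq_of_lt i.2, Nat.mod_eq_of_lt j.2] at h
  exact Fin.ext h

theorem ColorValue.eq_sum [MetricSpace X] {γ : ℝ → X} {L : ℝ} {v : Fin (n + 1)}
    (h : ColorValue PX r fr xhat proj cP γ L v) :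
    (maxIntervals (betaSet PX r xhat proj cP γ L)).Finite ∧
    (PX ∩ Function.support fun P => ((cP P (proj P (γ L)) : ℕ) : ZMod (n + 1))).Finite ∧
    ((v : ℕ) : ZMod (n + 1)) =
      pieceSum PX proj cP (γ L) + floorSum PX fr n γ (betaSet PX r xhat proj cP γ L) := by
  obtain ⟨Ps, k, a, b, hPs, hab, hB, hsep, hv⟩ := h
  have hmax := maxIntervals_iUnion_Icc hab hsep
  rw [← hB] at hmax
  have hsupp : (PX ∩ Function.support fun P => ((cP P (proj P (γ L)) : ℕ) : ZMod (n + 1))) = Ps := by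
    rw [hPs]
    ext P
    simp only [Set.mem_inter_iff, Function.mem_support, Set.mem_ofPred_eq]
    refine and_congr_right fun _ => not_congr ⟨fun h => ?_, fun h => by simp [h]⟩
    exact ZMod.natCast_fin_inj (by simpa using h)
  have hinj : Function.Injective fun i => (a i, b i) := by
    intro i j hij
    by_contra hne
    obtain ⟨h1, h2⟩ := Prod.mk.inj hij
    rcases hsep i j hne with h | h
    · linarith [hab i]
    · linarith [hab j]
  refine ⟨hmax ▸ Set.finite_range _, hsupp ▸ Ps.finite_toSet, ?_⟩
  have h1 : pieceSum PX proj cP (γ L) =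
      ∑ P ∈ Ps, ((cP P (proj P (γ L)) : ℕ) : ZMod (n + 1)) := by
    refine finsum_mem_eq_sum_of_inter_support_eq _ ?_
    rw [hsupp, ← hsupp]
    ext P
    simp
  have h2 : floorSum PX fr n γ (betaSet PX r xhat proj cP γ L) =
      ∑ i, (⌊floorLen PX γ (a i) (b i) / (99 * fr)⌋₊ : ZMod (n + 1)) := by
    rw [floorSum, hmax, finsum_mem_range hinj, finsum_eq_sum_of_fintype]
  rw [hv, ZMod.natCast_mod, h1, h2]
  push_cast
  rfl

end ColorFormula

section LongPieces

variable {X : Type*} [MetricSpace X] {PX : Set (Set X)} {n : ℕ} {r fr : ℝ} {xhat : X}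
  {proj : Set X → X → X} {cP : Set X → X → Fin (n + 1)}

/-- `P` is a long piece of `γ : [0, L] → X`, met by `γ` exactly in the parameters `[s, e]`. -/
def LongAt (PX : Set (Set X)) (r : ℝ) {n : ℕ} (xhat : X) (proj : Set X → X → X)
    (cP : Set X → X → Fin (n + 1)) (γ : ℝ → X) (L : ℝ) (P : Set X) (s e : ℝ) : Prop :=
  P ∈ PX ∧ Crosses γ L P s e ∧ γ e ∉ pieceComp r xhat proj cP P

/-- Two distinct pieces do not share a nondegenerate part of a geodesic. -/
theorem IsTreeGraded.not_shared (hT : IsTreeGraded X PX) {γ : ℝ → X} {L : ℝ}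
    (hγ : IsGeodesicSegment γ 0 L) {P Q : Set X} (hP : P ∈ PX) (hQ : Q ∈ PX) {a b : ℝ}
    (ha : 0 ≤ a) (hab : a < b) (hb : b ≤ L) (haP : γ a ∈ P) (hbP : γ b ∈ P) (haQ : γ a ∈ Q)
    (hbQ : γ b ∈ Q) : P = Q := by
  by_contra hne
  have := hγ.injOn ⟨ha, by linarith⟩ ⟨by linarith, hb⟩ (hT.t1 P hP Q hQ hne ⟨haP, haQ⟩ ⟨hbP, hbQ⟩)
  linarith

theorem IsTreeGraded.crosses_disjoint (hT : IsTreeGraded X PX) {γ : ℝ → X} {L : ℝ}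
    (hγ : IsGeodesicSegment γ 0 L) {P Q : Set X} (hP : P ∈ PX) (hQ : Q ∈ PX) (hne : P ≠ Q)
    {s e s' e' : ℝ} (hc : Crosses γ L P s e) (hc' : Crosses γ L Q s' e') (hse : s < e)
    (hse' : s' < e') : e ≤ s' ∨ e' ≤ s := by
  by_contra! hcon
  have h1 : max s s' < min e e' := by
    rw [max_lt_iff, lt_min_iff, lt_min_iff]
    exact ⟨⟨hse, hcon.2⟩, hcon.1, hse'⟩
  have h2 := le_max_left s s'
  have h3 := le_max_right s s'
  have h4 := min_le_left e e'
  have h5 := min_le_right e e'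
  exact hne (hT.not_shared hγ hP hQ (hc.1.trans h2) h1 (h4.trans hc.2.2.1)
    (hc.mem h2 (by linarith)) (hc.mem (by linarith) h4) (hc'.mem h3 (by linarith))
    (hc'.mem (by linarith) h5))

namespace ColoringSetup

theorem self_mem_pieceComp (h : ColoringSetup X PX n r fr xhat proj cP) {P : Set X} (hP : P ∈ PX) :
    proj P xhat ∈ pieceComp r xhat proj cP P := by
  refine ⟨0, fun _ => proj P xhat, rfl, rfl, fun _ _ => ⟨h.projMem P hP _, ?_⟩, by simp⟩
  exact h.ballZero P hP _ (h.projMem P hP _) (by rw [dist_self]; linarith [h.rpos])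

theorem color_of_mem_pieceComp {P : Set X} {y : X} (hy : y ∈ pieceComp r xhat proj cP P) :
    cP P y = 0 := by
  obtain ⟨m, c, -, hm, hc, -⟩ := hy
  exact hm ▸ (hc m le_rfl).2

theorem mem_pieceComp_of_dist_lt {P : Set X} {y z : X} (hy : y ∈ pieceComp r xhat proj cP P)
    (hz : z ∈ P) (hcz : cP P z = 0) (hyz : dist y z < r) : z ∈ pieceComp r xhat proj cP P := by
  obtain ⟨m, c, h0, hm, hc, hs⟩ := hy
  refine ⟨m + 1, fun i => if i ≤ m then c i else z, by simpa using h0, by simp, ?_, ?_⟩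
  · intro i _
    dsimp only
    split_ifs with hi
    · exact hc i hi
    · exact ⟨hz, hcz⟩
  · intro i hi
    have him : i ≤ m := by omega
    dsimp only
    rw [if_pos him]
    split_ifs with hi'
    · exact hs i (by omega)
    · have : i = m := by omega
      rw [this, hm]; exact hyz

theorem mem_pieceComp_of_dist_le (h : ColoringSetup X PX n r fr xhat proj cP) {P : Set X}
    (hP : P ∈ PX) {y : X} (hy : y ∈ P) (hd : dist (proj P xhat) y ≤ 2 * r) :
    y ∈ pieceComp r xhat proj cP P := by
  have hr := h.rpos
  obtain ⟨σ, hσ, hσ0, hσ1, hσP⟩ := h.treeGraded.geodesicSub P hP _ (h.projMem P hP xhat) y hy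
  set d := dist (proj P xhat) y with hd'
  have hd0 : 0 ≤ d := dist_nonneg
  have hz : ∀ t ∈ Set.Icc 0 d, cP P (σ t) = 0 := by
    intro t ht
    refine h.ballZero P hP _ (hσP t ht) ?_
    rw [← hσ0, hσ t ht 0 ⟨le_rfl, hd0⟩, sub_zero, abs_of_nonneg ht.1]
    linarith [ht.2]
  have step : ∀ s ∈ Set.Icc 0 d, ∀ t ∈ Set.Icc 0 d, s ≤ t → t - s < r →
      σ s ∈ pieceComp r xhat proj cP P → σ t ∈ pieceComp r xhat proj cP P := by
    intro s hs t ht hst hlt hmem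
    refine mem_pieceComp_of_dist_lt hmem (hσP t ht) (hz t ht) ?_
    rw [hσ s hs t ht, abs_of_nonpos (by linarith)]
    linarith
  have m0 : σ 0 ∈ pieceComp r xhat proj cP P := hσ0 ▸ h.self_mem_pieceComp hP
  have m1 := step 0 ⟨le_rfl, hd0⟩ (d / 3) ⟨by linarith, by linarith⟩ (by linarith)
    (by linarith) m0
  have m2 := step (d / 3) ⟨by linarith, by linarith⟩ (2 * d / 3) ⟨by linarith, by linarith⟩
    (by linarith) (by linarith) m1
  have m3 := step (2 * d / 3) ⟨by linarith, by linarith⟩ d ⟨by linarith, by linarith⟩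
    (by linarith) (by linarith) m2
  rwa [hσ1] at m3

theorem dist_le_of_mem_pieceComp (h : ColoringSetup X PX n r fr xhat proj cP) {P : Set X}
    (hP : P ∈ PX) {y : X} (hy : y ∈ pieceComp r xhat proj cP P) :
    dist (proj P xhat) y ≤ 8 * fr :=
  h.zeroBounded P hP _ _ hy

theorem isLongPiece_iff (h : ColoringSetup X PX n r fr xhat proj cP) {γ : ℝ → X} {L : ℝ}
    (hγ : IsGeodesicSegment γ 0 L) {P : Set X} :
    IsLongPiece PX r xhat proj cP γ L P ↔ ∃ s e, LongAt PX r xhat proj cP γ L P s e := by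
  constructor
  · rintro ⟨hP, ⟨t, ht, htP⟩, hn⟩
    obtain ⟨s, e, hc⟩ := h.treeGraded.exists_crosses hP hγ ht htP
    rw [h.proj_end_eq hγ hP hc] at hn
    exact ⟨s, e, hP, hc, hn⟩
  · rintro ⟨s, e, hP, hc, hn⟩
    refine ⟨hP, ⟨s, ⟨hc.1, hc.2.1.trans hc.2.2.1⟩, hc.start_mem⟩, ?_⟩
    rwa [h.proj_end_eq hγ hP hc]

theorem mem_betaSet_iff (h : ColoringSetup X PX n r fr xhat proj cP) {γ : ℝ → X} {L : ℝ}
    (hγ : IsGeodesicSegment γ 0 L) {t : ℝ} :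
    t ∈ betaSet PX r xhat proj cP γ L ↔ t ∈ Set.Icc 0 L ∧
      ∀ P s e, LongAt PX r xhat proj cP γ L P s e → ¬ (s + r / 2 < t ∧ t < e) := by
  rw [betaSet, Set.mem_sdiff]
  refine and_congr_right fun _ => ?_
  simp only [Set.mem_iUnion, not_exists]
  constructor
  · intro hn P s e hl ht
    refine hn P ((h.isLongPiece_iff hγ).2 ⟨s, e, hl⟩) ?_
    rw [hl.2.1.pieceStart_eq, hl.2.1.pieceEnd_eq]
    exact ht
  · intro hn P hl ht
    obtain ⟨s, e, hl'⟩ := (h.isLongPiece_iff hγ).1 hl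
    rw [hl'.2.1.pieceStart_eq, hl'.2.1.pieceEnd_eq] at ht
    exact hn P s e hl' ht

theorem longAt_lt (h : ColoringSetup X PX n r fr xhat proj cP) {γ : ℝ → X} {L : ℝ}
    (hγ : IsGeodesicSegment γ 0 L) (hγ0 : γ 0 = xhat) {P : Set X} {s e : ℝ}
    (hl : LongAt PX r xhat proj cP γ L P s e) : s + 2 * r < e := by
  obtain ⟨hP, hc, hn⟩ := hl
  by_contra! hle
  refine hn (h.mem_pieceComp_of_dist_le hP hc.end_mem ?_)
  have := hc.1
  have := hc.2.1
  have := hc.2.2.1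
  rw [← hγ0, h.proj_start_eq hγ hP hc, hγ s ⟨by linarith, by linarith⟩ e
    ⟨by linarith, by linarith⟩, abs_of_nonpos (by linarith)]
  linarith

theorem longAt_disjoint (h : ColoringSetup X PX n r fr xhat proj cP) {γ : ℝ → X} {L : ℝ}
    (hγ : IsGeodesicSegment γ 0 L) (hγ0 : γ 0 = xhat) {P Q : Set X} {s e s' e' : ℝ}
    (hne : P ≠ Q) (hl : LongAt PX r xhat proj cP γ L P s e)
    (hl' : LongAt PX r xhat proj cP γ L Q s' e') : e ≤ s' ∨ e' ≤ s := by
  have h1 := h.longAt_lt hγ hγ0 hl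
  have h2 := h.longAt_lt hγ hγ0 hl'
  have h3 := h.rpos
  exact h.treeGraded.crosses_disjoint hγ hl.1 hl'.1 hne hl.2.1 hl'.2.1 (by linarith) (by linarith)

/-- A piece contributing to the color of the endpoint of `γ` is a long piece of `γ`. -/
theorem exists_longAt_of_color_ne_zero (h : ColoringSetup X PX n r fr xhat proj cP) {γ : ℝ → X}
    {L : ℝ} (hL : 0 ≤ L) (hγ : IsGeodesicSegment γ 0 L) (hγ0 : γ 0 = xhat) {P : Set X}
    (hP : P ∈ PX) (hne : cP P (proj P (γ L)) ≠ 0) :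
    ∃ s e, LongAt PX r xhat proj cP γ L P s e := by
  refine (h.isLongPiece_iff hγ).1 ⟨hP, ?_, fun hm => hne (color_of_mem_pieceComp hm)⟩
  by_contra! hm
  rw [h.proj_eq_of_not_meet hL hγ hP hm, hγ0] at hne
  exact hne (color_of_mem_pieceComp (h.self_mem_pieceComp hP))

theorem color_proj_eq_of_longAt_iff (h : ColoringSetup X PX n r fr xhat proj cP) {γ : ℝ → X}
    {L w : ℝ} (hw : w ∈ Set.Icc 0 L) (hγ : IsGeodesicSegment γ 0 L) (hγ0 : γ 0 = xhat) {P : Set X}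
    (hP : P ∈ PX) (hiff : ∀ s e, LongAt PX r xhat proj cP γ L P s e ↔
      LongAt PX r xhat proj cP γ w P s e) :
    cP P (proj P (γ L)) = cP P (proj P (γ w)) := by
  have hγw := hγ.mono le_rfl hw.2
  have key : (∃ s e, LongAt PX r xhat proj cP γ L P s e) →
      cP P (proj P (γ L)) = cP P (proj P (γ w)) := by
    rintro ⟨s, e, hl⟩
    rw [h.proj_end_eq hγ hP hl.2.1, h.proj_end_eq hγw hP ((hiff s e).1 hl).2.1]
  by_cases h1 : cP P (proj P (γ L)) = 0
  · by_cases h2 : cP P (proj P (γ w)) = 0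
    · rw [h1, h2]
    · obtain ⟨s, e, hl⟩ := h.exists_longAt_of_color_ne_zero hw.1 hγw hγ0 hP h2
      exact key ⟨s, e, (hiff s e).2 hl⟩
  · exact key (h.exists_longAt_of_color_ne_zero (hw.1.trans hw.2) hγ hγ0 hP h1)

/-- Being a long piece before the parameter `u` depends only on the geodesic up to `u`,
provided the geodesic is not in the piece after `u`. -/
theorem _root_.LongAt.transfer {γ γ₁ : ℝ → X} {L L₁ u : ℝ} {Q : Set X} {s e : ℝ}
    (hl : LongAt PX r xhat proj cP γ₁ L₁ Q s e) (he : e ≤ u) (hu₁ : u ≤ L₁) (hu : u ≤ L)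
    (heq : Set.EqOn γ₁ γ (Set.Icc 0 u)) (hout : ∀ t ∈ Set.Ioc u L, γ t ∉ Q) :
    LongAt PX r xhat proj cP γ L Q s e := by
  obtain ⟨hQ, hc, hn⟩ := hl
  refine ⟨hQ, ⟨hc.1, hc.2.1, he.trans hu, fun t ht => ?_⟩, ?_⟩
  · rcases le_or_gt t u with htu | htu
    · rw [← heq ⟨ht.1, htu⟩]
      exact hc.2.2.2 t ⟨ht.1, htu.trans hu₁⟩
    · exact iff_of_false (hout t ⟨htu, ht.2⟩) fun h => by linarith [h.2]
  · rwa [← heq ⟨hc.1.trans hc.2.1, he⟩]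

theorem not_mem_of_end_lt (h : ColoringSetup X PX n r fr xhat proj cP) {γ γ₁ : ℝ → X}
    {L L₁ u : ℝ} (hγ : IsGeodesicSegment γ 0 L) {Q : Set X} (hQ : Q ∈ PX) {s e : ℝ}
    (hc : Crosses γ₁ L₁ Q s e) (he : e < u) (hu₁ : u ≤ L₁)
    (heq : Set.EqOn γ₁ γ (Set.Icc 0 u)) : ∀ t ∈ Set.Ioc u L, γ t ∉ Q := by
  intro t ht htQ
  have he0 := hc.1.trans hc.2.1
  have h1 : γ e ∈ Q := by
    rw [← heq ⟨he0, he.le⟩]; exact hc.end_mem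
  have h2 := h.treeGraded.mem_of_mem_of_mem hQ hγ he0 he.le ht.1.le ht.2 h1 htQ
  rw [← heq ⟨he0.trans he.le, le_rfl⟩] at h2
  linarith [((hc.2.2.2 u ⟨he0.trans he.le, hu₁⟩).1 h2).2]

end ColoringSetup

end LongPieces

section ColorRecursion

variable {X : Type*} [MetricSpace X] {PX : Set (Set X)} {n : ℕ} {r fr : ℝ} {xhat : X}
  {proj : Set X → X → X} {cP : Set X → X → Fin (n + 1)}

theorem IsTreeGraded.floorLen_le (hT : IsTreeGraded X PX) {γ : ℝ → X} {a b : ℝ} (hab : a ≤ b) :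
    floorLen PX γ a b ≤ b - a := by
  obtain ⟨P, hP, hbP⟩ := hT.covers (γ b)
  refine floorLen_le_of_mem ⟨hab, le_rfl⟩ hP ?_
  rwa [Set.Icc_self, Set.image_singleton, Set.singleton_subset_iff]

theorem IsTreeGraded.le_floorLen (hT : IsTreeGraded X PX) {γ : ℝ → X} {a b u : ℝ} (hab : a ≤ b)
    (hu : ∀ t ∈ Set.Icc a b, ∀ P ∈ PX, γ '' Set.Icc t b ⊆ P → u ≤ t) :
    u - a ≤ floorLen PX γ a b := by
  have hb : b ∈ {t | t ∈ Set.Icc a b ∧ ∃ P ∈ PX, γ '' Set.Icc t b ⊆ P} := by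
    obtain ⟨P, hP, hbP⟩ := hT.covers (γ b)
    refine ⟨⟨hab, le_rfl⟩, P, hP, ?_⟩
    rw [Set.Icc_self, Set.image_singleton, Set.singleton_subset_iff]
    exact hbP
  have := le_csInf (a := u) ⟨b, hb⟩ fun t ht => by
    obtain ⟨ht, P, hP, hs⟩ := ht
    exact hu t ht P hP hs
  unfold floorLen
  linarith

theorem IsTreeGraded.floorLen_self (hT : IsTreeGraded X PX) {γ : ℝ → X} {a : ℝ} :
    floorLen PX γ a a = 0 := by
  have h1 := hT.floorLen_le (γ := γ) (le_refl a)
  have h2 := hT.le_floorLen (γ := γ) (u := a) (le_refl a) fun t ht _ _ _ => ht.1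
  linarith

namespace ColoringSetup

/-- If all long pieces of `γ` end before `w`, and `w` is an endpoint of a long piece, then the
color changes after `w` according to the floored length of `γ` after `w`. -/
theorem color_eq_add_floor (h : ColoringSetup X PX n r fr xhat proj cP) {cX : X → Fin (n + 1)}
    (hcX : ∀ (γ : ℝ → X) (L : ℝ), 0 ≤ L → IsGeodesicSegment γ 0 L → γ 0 = xhat →
      ColorValue PX r fr xhat proj cP γ L (cX (γ L)))
    {γ : ℝ → X} {L w : ℝ} (hγ : IsGeodesicSegment γ 0 L) (hγ0 : γ 0 = xhat)
    (hw : w ∈ Set.Icc 0 L) (hctx : w = 0 ∨ ∃ Q s, LongAt PX r xhat proj cP γ L Q s w)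
    (hend : ∀ Q s e, LongAt PX r xhat proj cP γ L Q s e → e ≤ w) :
    ((cX (γ L) : ℕ) : ZMod (n + 1)) =
      (cX (γ w) : ℕ) + (⌊floorLen PX γ w L / (99 * fr)⌋₊ : ZMod (n + 1)) := by
  have hr := h.rpos
  have hγw := hγ.mono le_rfl hw.2
  have hto : ∀ Q s e, LongAt PX r xhat proj cP γ L Q s e → LongAt PX r xhat proj cP γ w Q s e :=
    fun Q s e hl => hl.transfer (hend Q s e hl) hw.2 le_rfl (fun _ _ => rfl)
      fun t ht => by linarith [ht.1, ht.2]
  have hiff : ∀ Q s e, LongAt PX r xhat proj cP γ L Q s e ↔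
      LongAt PX r xhat proj cP γ w Q s e := by
    refine fun Q s e => ⟨hto Q s e, fun hl => ?_⟩
    rcases lt_or_eq_of_le hl.2.1.2.2.1 with he | rfl
    · exact hl.transfer he.le le_rfl hw.2 (fun _ _ => rfl)
        (h.not_mem_of_end_lt hγ hl.1 hl.2.1 he le_rfl fun _ _ => rfl)
    · have h1 := h.longAt_lt hγw hγ0 hl
      have h2 := hl.2.1.1
      rcases hctx with rfl | ⟨Q₀, s₀, hl₀⟩
      · linarith
      · have hl₀' := hto _ _ _ hl₀
        have h3 := h.longAt_lt hγw hγ0 hl₀'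
        by_cases hQ : Q = Q₀
        · subst hQ
          rw [(hl.2.1.unique hl₀'.2.1).1]
          exact hl₀
        · rcases h.longAt_disjoint hγw hγ0 hQ hl hl₀' with h4 | h4 <;> linarith
  obtain ⟨-, -, h1⟩ := (hcX γ L (hw.1.trans hw.2) hγ hγ0).eq_sum
  obtain ⟨hfin, -, h2⟩ := (hcX γ w hw.1 hγw hγ0).eq_sum
  have hp : pieceSum PX proj cP (γ L) = pieceSum PX proj cP (γ w) :=
    finsum_mem_congr rfl fun P hP => by
      rw [h.color_proj_eq_of_longAt_iff hw hγ hγ0 hP (hiff P)]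
  have hBL : betaSet PX r xhat proj cP γ L =
      (betaSet PX r xhat proj cP γ w \ {w}) ∪ Set.Icc w L := by
    ext t
    rw [Set.mem_union, Set.mem_sdiff, h.mem_betaSet_iff hγ, h.mem_betaSet_iff hγw]
    simp only [hiff, Set.mem_singleton_iff, Set.mem_Icc]
    constructor
    · rintro ⟨⟨h3, h4⟩, h5⟩
      rcases lt_or_ge t w with h6 | h6
      · exact Or.inl ⟨⟨⟨h3, h6.le⟩, h5⟩, h6.ne⟩
      · exact Or.inr ⟨h6, h4⟩
    · rintro (⟨⟨⟨h3, h4⟩, h5⟩, -⟩ | ⟨h3, h4⟩)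
      · exact ⟨⟨h3, h4.trans hw.2⟩, h5⟩
      · exact ⟨⟨hw.1.trans h3, h4⟩, fun P s e hl hlt => by
          linarith [hend P s e ((hiff P s e).2 hl)]⟩
  have hBw : betaSet PX r xhat proj cP γ w =
      (betaSet PX r xhat proj cP γ w \ {w}) ∪ Set.Icc w w := by
    rw [Set.Icc_self, Set.sdiff_union_self, Set.union_eq_left.2]
    rw [Set.singleton_subset_iff, h.mem_betaSet_iff hγw]
    exact ⟨⟨hw.1, le_rfl⟩, fun P s e hl hlt => by linarith [hl.2.1.2.2.1]⟩
  obtain ⟨m, hm, hB⟩ : ∃ m < w, ∀ t ∈ betaSet PX r xhat proj cP γ w \ {w}, t ≤ m := by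
    rcases hctx with rfl | ⟨Q₀, s₀, hl₀⟩
    · refine ⟨-1, by norm_num, fun t ht => ?_⟩
      have := ((h.mem_betaSet_iff hγw).1 ht.1).1
      exact (ht.2 (le_antisymm this.2 this.1)).elim
    · have h3 := h.longAt_lt hγ hγ0 hl₀
      refine ⟨s₀ + r / 2, by linarith, fun t ht => ?_⟩
      obtain ⟨h4, h5⟩ := (h.mem_betaSet_iff hγw).1 ht.1
      by_contra! hlt
      exact h5 Q₀ s₀ w (hto _ _ _ hl₀) ⟨hlt, lt_of_le_of_ne h4.2 ht.2⟩
  have hfin' : (maxIntervals (betaSet PX r xhat proj cP γ w \ {w})).Finite := by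
    rw [hBw, maxIntervals_union_Icc hB hm le_rfl] at hfin
    exact hfin.subset (Set.subset_insert _ _)
  rw [h1, h2, hp, hBL, floorSum_union_Icc hfin' hB hm hw.2]
  conv_rhs => rw [hBw, floorSum_union_Icc hfin' hB hm le_rfl, h.treeGraded.floorLen_self]
  rw [zero_div, Nat.floor_zero, Nat.cast_zero, add_zero, add_assoc]

/-- The color of a point in the last, long, piece of a geodesic. -/
theorem color_eq_add_color (h : ColoringSetup X PX n r fr xhat proj cP) {cX : X → Fin (n + 1)}
    (hcX : ∀ (γ : ℝ → X) (L : ℝ), 0 ≤ L → IsGeodesicSegment γ 0 L → γ 0 = xhat →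
      ColorValue PX r fr xhat proj cP γ L (cX (γ L)))
    {γ : ℝ → X} {L s : ℝ} (hγ : IsGeodesicSegment γ 0 L) (hγ0 : γ 0 = xhat) {P : Set X}
    (hl : LongAt PX r xhat proj cP γ L P s L) :
    ((cX (γ L) : ℕ) : ZMod (n + 1)) =
      (cX (γ (s + r / 2)) : ℕ) + ((cP P (γ L) : ℕ) : ZMod (n + 1)) := by
  have hr := h.rpos
  have hs := hl.2.1.1
  have hlt := h.longAt_lt hγ hγ0 hl
  set v := s + r / 2 with hv
  have hv0 : v ∈ Set.Icc 0 L := ⟨by linarith, by linarith⟩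
  have hγv := hγ.mono le_rfl hv0.2
  have hcv : Crosses γ v P s v := by
    refine ⟨hs, by linarith, le_rfl, fun t ht => ?_⟩
    rw [hl.2.1.2.2.2 t ⟨ht.1, ht.2.trans hv0.2⟩]
    exact and_congr_right fun _ => ⟨fun _ => ht.2, fun h => h.trans hv0.2⟩
  have hvP : γ v ∈ P := hcv.end_mem
  have hvc : γ v ∈ pieceComp r xhat proj cP P := by
    refine h.mem_pieceComp_of_dist_le hl.1 hvP ?_
    rw [← hγ0, h.proj_start_eq hγ hl.1 hl.2.1, hγ s ⟨hs, by linarith⟩ v hv0,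
      abs_of_nonpos (by linarith)]
    linarith
  have hiff : ∀ Q s' e', Q ≠ P → (LongAt PX r xhat proj cP γ L Q s' e' ↔
      LongAt PX r xhat proj cP γ v Q s' e') := by
    refine fun Q s' e' hQ => ⟨fun hl' => ?_, fun hl' => ?_⟩
    · have h1 := h.longAt_lt hγ hγ0 hl'
      have h2 := hl'.2.1.2.2.1
      refine hl'.transfer ?_ hv0.2 le_rfl (fun _ _ => rfl) fun t ht => by linarith [ht.1, ht.2]
      rcases h.longAt_disjoint hγ hγ0 hQ hl' hl with h3 | h3 <;> linarith
    · have h1 := h.longAt_lt hγv hγ0 hl'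
      have h2 := hl'.2.1.2.2.1
      rcases lt_or_eq_of_le h2 with he | rfl
      · exact hl'.transfer he.le le_rfl hv0.2 (fun _ _ => rfl)
          (h.not_mem_of_end_lt hγ hl'.1 hl'.2.1 he le_rfl fun _ _ => rfl)
      · rcases h.treeGraded.crosses_disjoint hγv hl'.1 hl.1 hQ hl'.2.1 hcv (by linarith)
          (by linarith) with h3 | h3 <;> linarith
  obtain ⟨-, hf1, h1⟩ := (hcX γ L (hv0.1.trans hv0.2) hγ hγ0).eq_sum
  obtain ⟨hfin, hf2, h2⟩ := (hcX γ v hv0.1 hγv hγ0).eq_sum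
  have hPX : PX = insert P (PX \ {P}) := by
    rw [Set.insert_sdiff_singleton, Set.insert_eq_of_mem hl.1]
  have hp : pieceSum PX proj cP (γ L) =
      pieceSum PX proj cP (γ v) + ((cP P (γ L) : ℕ) : ZMod (n + 1)) := by
    unfold pieceSum
    conv_lhs => rw [hPX]
    conv_rhs => rw [hPX]
    rw [finsum_mem_insert' _ (by simp)
        (hf1.subset (Set.inter_subset_inter_left _ Set.sdiff_subset)),
      finsum_mem_insert' _ (by simp)
        (hf2.subset (Set.inter_subset_inter_left _ Set.sdiff_subset)),
      h.proj_of_mem hl.1 hl.2.1.end_mem, h.proj_of_mem hl.1 hvP, color_of_mem_pieceComp hvc,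
      Fin.val_zero, Nat.cast_zero, zero_add]
    refine (congrArg _ (finsum_mem_congr rfl fun Q hQ => ?_)).trans (add_comm _ _)
    rw [h.color_proj_eq_of_longAt_iff hv0 hγ hγ0 hQ.1 fun s' e' => hiff Q s' e' hQ.2]
  have hBL : betaSet PX r xhat proj cP γ L =
      betaSet PX r xhat proj cP γ v ∪ Set.Icc L L := by
    ext t
    rw [Set.mem_union, h.mem_betaSet_iff hγ, h.mem_betaSet_iff hγv]
    constructor
    · rintro ⟨h3, h4⟩
      rcases lt_or_eq_of_le h3.2 with h5 | rfl
      · left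
        have h6 : t ≤ v := by
          by_contra! h6
          exact h4 P s L hl ⟨h6, h5⟩
        refine ⟨⟨h3.1, h6⟩, fun Q s' e' hl' => ?_⟩
        by_cases hQ : Q = P
        · subst hQ
          rw [(hl'.2.1.unique hcv).1]
          exact fun h7 => by linarith
        · exact h4 Q s' e' ((hiff Q s' e' hQ).2 hl')
      · exact Or.inr ⟨le_rfl, le_rfl⟩
    · rintro (⟨h3, h4⟩ | h3)
      · refine ⟨⟨h3.1, h3.2.trans hv0.2⟩, fun Q s' e' hl' => ?_⟩
        by_cases hQ : Q = P
        · subst hQ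
          rw [(hl'.2.1.unique hl.2.1).1]
          exact fun h7 => by linarith [h3.2]
        · exact h4 Q s' e' ((hiff Q s' e' hQ).1 hl')
      · exact ⟨⟨by linarith [h3.1, hv0.1, hv0.2], h3.2⟩, fun Q s' e' hl' h7 => by
          linarith [h3.1, hl'.2.1.2.2.1]⟩
  rw [h1, h2, hp, hBL, floorSum_union_Icc hfin (m := v)
    (fun t ht => ((h.mem_betaSet_iff hγv).1 ht).1.2) (by linarith) le_rfl,
    h.treeGraded.floorLen_self, zero_div, Nat.floor_zero, Nat.cast_zero, add_zero]
  ring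

end ColoringSetup

end ColorRecursion

section Windows

variable {X : Type*} [MetricSpace X] {PX : Set (Set X)} {n : ℕ} {r fr : ℝ} {xhat : X}
  {proj : Set X → X → X} {cP : Set X → X → Fin (n + 1)}

theorem IsGeodesicSegment.exists_concat {γ σ : ℝ → X} {u d : ℝ} (hu : 0 ≤ u) (hd : 0 ≤ d)
    (hγ : IsGeodesicSegment γ 0 u) (hσ : IsGeodesicSegment σ 0 d) (hj : γ u = σ 0)
    (hdist : dist (γ 0) (σ d) = u + d) :
    ∃ γ₁ : ℝ → X, IsGeodesicSegment γ₁ 0 (u + d) ∧ Set.EqOn γ₁ γ (Set.Icc 0 u) ∧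
      ∀ t ∈ Set.Icc 0 d, γ₁ (u + t) = σ t := by
  have hmix : ∀ s ∈ Set.Icc 0 u, ∀ t ∈ Set.Icc 0 d, dist (γ s) (σ t) = u - s + t := by
    intro s hs t ht
    have h1 := hγ 0 ⟨le_rfl, hu⟩ s hs
    have h2 := hγ s hs u ⟨hu, le_rfl⟩
    have h3 := hσ 0 ⟨le_rfl, hd⟩ t ht
    have h4 := hσ t ht d ⟨hd, le_rfl⟩
    rw [abs_of_nonpos (by linarith [hs.1, hs.2, ht.1, ht.2])] at h1 h2 h3 h4
    have h5 := dist_triangle (γ s) (γ u) (σ t)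
    have h6 := dist_triangle4 (γ 0) (γ s) (σ t) (σ d)
    rw [hj] at h5 h2
    linarith
  refine ⟨fun t => if t ≤ u then γ t else σ (t - u), ?_, fun t ht => if_pos ht.2, ?_⟩
  · intro s hs t ht
    dsimp only
    split_ifs with h1 h2 h2
    · exact hγ s ⟨hs.1, h1⟩ t ⟨ht.1, h2⟩
    · rw [hmix s ⟨hs.1, h1⟩ (t - u) ⟨by linarith, by linarith [ht.2]⟩,
        abs_of_nonpos (by linarith)]
      ring
    · rw [dist_comm, hmix t ⟨ht.1, h2⟩ (s - u) ⟨by linarith, by linarith [hs.2]⟩,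
        abs_of_nonneg (by linarith)]
      ring
    · rw [hσ (s - u) ⟨by linarith, by linarith [hs.2]⟩ (t - u)
        ⟨by linarith, by linarith [ht.2]⟩]
      congr 1
      ring
  · intro t ht
    rcases eq_or_lt_of_le ht.1 with rfl | h0
    · simp [hj]
    · simp [not_le.2 h0]

/-- The parameter `u` is not interior to the intersection of `γ : [0, L] → X` with a piece. -/
def NonStraddled (PX : Set (Set X)) (γ : ℝ → X) (L u : ℝ) : Prop :=
  ∀ P ∈ PX, ∀ t₁ t₂, 0 ≤ t₁ → t₁ < u → u < t₂ → t₂ ≤ L → γ t₁ ∈ P → γ t₂ ∉ P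

/-- A point of a geodesic interior to no piece separates the two parts of the geodesic. -/
theorem IsTreeGraded.not_arcIn_of_nonStraddled (hT : IsTreeGraded X PX) {γ : ℝ → X} {L u : ℝ}
    (hγ : IsGeodesicSegment γ 0 L) (hu : u ∈ Set.Icc 0 L) (hns : NonStraddled PX γ L u) {t : ℝ}
    (ht : 0 ≤ t) (htu : t < u) : ¬ ArcIn {γ u}ᶜ (γ t) (γ L) := by
  rintro ⟨f, l, hl, hc, hi, h0, h1, hS⟩
  obtain ⟨g, hg, hge⟩ := hγ.exists_continuous (hu.1.trans hu.2)
  have hcl : ∀ p q, IsClosed (g '' Set.Icc p q) := fun p q => (isCompact_Icc.image hg).isClosed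
  have hgu := hge hu
  obtain ⟨a, ha, -, ⟨t₁, ht₁, hat⟩, hamax⟩ := exists_last_mem (hcl 0 u) hc.continuousOn
    (c := 0) (a := 0) (b := l) ⟨le_rfl, hl⟩
    ⟨t, ⟨ht, htu.le⟩, by rw [h0, hge ⟨ht, htu.le.trans hu.2⟩]⟩
  obtain ⟨b, hb, -, ⟨t₂, ht₂, hbt⟩, hbmin⟩ := exists_first_mem (hcl u L) hc.continuousOn
    (c := l) (a := a) (b := l) ⟨ha.2, le_rfl⟩
    ⟨L, ⟨hu.2, le_rfl⟩, by rw [h1, hge ⟨hu.1.trans hu.2, le_rfl⟩]⟩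
  have hb0 : b ∈ Set.Icc 0 l := ⟨ha.1.trans hb.1, hb.2⟩
  have hlt₁ : t₁ < u := lt_of_le_of_ne ht₁.2 fun h => hS a ha (by rw [← hat, h, hgu]; rfl)
  have hlt₂ : u < t₂ := lt_of_le_of_ne ht₂.1 fun h => hS b hb0 (by rw [← hbt, ← h, hgu]; rfl)
  have hgi : Set.InjOn g (Set.Icc 0 L) := hγ.injOn.congr hge.symm
  have hab : a < b := by
    refine lt_of_le_of_ne hb.1 fun h => ?_
    have := hgi ⟨ht₁.1, ht₁.2.trans hu.2⟩ ⟨hu.1.trans ht₂.1, ht₂.2⟩ (by rw [hat, hbt, h])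
    linarith
  obtain ⟨Q, hQ, -, hgQ⟩ := hT.exists_piece_of_two_arcs (f := fun s => f (a + s))
    (g := fun s => g (t₁ + s)) (l := b - a) (k := t₂ - t₁) (by linarith) (by linarith)
    (by fun_prop) (by fun_prop)
    (by
      intro s hs s' hs' hss
      have := hi (x₁ := a + s) (x₂ := a + s') ⟨by linarith [hs.1, ha.1], by linarith [hs.2, hb.2]⟩
        ⟨by linarith [hs'.1, ha.1], by linarith [hs'.2, hb.2]⟩ hss
      linarith)
    (by
      intro s hs s' hs' hss
      have := hgi (x₁ := t₁ + s) (x₂ := t₁ + s')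
        ⟨by linarith [hs.1, ht₁.1], by linarith [hs.2, ht₂.2]⟩
        ⟨by linarith [hs'.1, ht₁.1], by linarith [hs'.2, ht₂.2]⟩ hss
      linarith)
    (by simp [hat]) (by simp [hbt])
    (by
      intro s hs s' hs' hss
      have hs1 : t₁ + s' ∈ Set.Icc 0 L := ⟨by linarith [hs'.1, ht₁.1], by linarith [hs'.2, ht₂.2]⟩
      rcases le_or_gt (t₁ + s') u with hle | hle
      · have h3 := hamax (a + s) ⟨by linarith [hs.1, ha.1], by linarith [hs.2, hb.2]⟩
          ⟨t₁ + s', ⟨hs1.1, hle⟩, hss.symm⟩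
        have h4 : s = 0 := by linarith [hs.1]
        subst h4
        have h5 := hgi (x₁ := t₁) ⟨ht₁.1, by linarith [hu.2]⟩ hs1 (by
          rw [hat, ← hss, add_zero])
        exact Or.inl ⟨rfl, by linarith⟩
      · have h3 := hbmin (a + s) ⟨by linarith [hs.1], by linarith [hs.2, hb.2]⟩
          ⟨t₁ + s', ⟨hle.le, hs1.2⟩, hss.symm⟩
        have h4 : s = b - a := by linarith [hs.2]
        subst h4
        have h5 := hgi (x₁ := t₂) ⟨hu.1.trans ht₂.1, ht₂.2⟩ hs1 (by
          rw [hbt, ← hss, add_sub_cancel])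
        exact Or.inr ⟨rfl, by linarith⟩)
  have q1 := hgQ 0 ⟨le_rfl, by linarith⟩
  have q2 := hgQ (t₂ - t₁) ⟨by linarith, le_rfl⟩
  rw [add_zero, hge ⟨ht₁.1, ht₁.2.trans hu.2⟩] at q1
  rw [add_sub_cancel, hge ⟨hu.1.trans ht₂.1, ht₂.2⟩] at q2
  exact hns Q hQ t₁ t₂ ht₁.1 hlt₁ hlt₂ ht₂.2 q1 q2

theorem exists_step_out {Y : Type*} {c : ℕ → Y} {m : ℕ} {A : Set Y} (h0 : c 0 ∈ A)
    (hm : c m ∉ A) : ∃ i < m, (∀ j ≤ i, c j ∈ A) ∧ c (i + 1) ∉ A := by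
  classical
  have hex : ∃ k, c k ∉ A := ⟨m, hm⟩
  obtain ⟨i, hi⟩ : ∃ i, Nat.find hex = i + 1 :=
    Nat.exists_eq_succ_of_ne_zero fun h => by
      have := Nat.find_spec hex
      rw [h] at this
      exact this h0
  have h1 := Nat.find_spec hex
  have h2 := Nat.find_min' hex hm
  rw [hi] at h1 h2
  refine ⟨i, h2, fun j hj => ?_, h1⟩
  by_contra hj'
  have := Nat.find_min' hex hj'
  omega

namespace ColoringSetup

theorem dist_add_dist_of_not_arcIn (h : ColoringSetup X PX n r fr xhat proj cP) {p y z : X}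
    (hn : ¬ ArcIn {p}ᶜ y z) : dist y p + dist p z = dist y z := by
  obtain ⟨σ, hσ, hσ0, hσ1⟩ := h.geodesic y z
  obtain ⟨t, ht, htp⟩ : ∃ t ∈ Set.Icc 0 (dist y z), σ t = p := by
    by_contra! hcon
    have := hσ.arcIn (S := {p}ᶜ) dist_nonneg fun t ht => hcon t ht
    rw [hσ0, hσ1] at this
    exact hn this
  have h1 := hσ 0 ⟨le_rfl, dist_nonneg⟩ t ht
  have h2 := hσ t ht _ ⟨dist_nonneg, le_rfl⟩
  rw [abs_of_nonpos (by linarith [ht.1, ht.2])] at h1 h2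
  rw [hσ0, htp] at h1
  rw [hσ1, htp] at h2
  linarith

/-- When an `r`-chain of color `co` along `γ` passes through a point `γ u` interior to no piece,
and there are no long pieces of `γ` between `w` and `u`, then `co` is determined, up to a small
error, by `u - w`. -/
theorem color_of_window (h : ColoringSetup X PX n r fr xhat proj cP) {cX : X → Fin (n + 1)}
    (hcX : ∀ (γ : ℝ → X) (L : ℝ), 0 ≤ L → IsGeodesicSegment γ 0 L → γ 0 = xhat →
      ColorValue PX r fr xhat proj cP γ L (cX (γ L)))
    {γ : ℝ → X} {L tm : ℝ} (hγ : IsGeodesicSegment γ 0 L) (hγ0 : γ 0 = xhat) (htm : 0 ≤ tm)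
    {co : Fin (n + 1)} {m : ℕ} {c : ℕ → X} (hc0 : c 0 = γ L) (hcm : c m = γ tm)
    (hcolor : ∀ i < m, cX (c i) = co) (hstep : ∀ i < m, dist (c i) (c (i + 1)) < r)
    {w u : ℝ} (hw0 : 0 ≤ w) (hctx : w = 0 ∨ ∃ Q s, LongAt PX r xhat proj cP γ L Q s w)
    (htmu : tm < u) (hwu : w ≤ u) (huL : u < L)
    (hlong : ∀ Q s e, LongAt PX r xhat proj cP γ L Q s e → e ≤ w ∨ u ≤ s)
    (hns : NonStraddled PX γ L u) :
    ∃ fl, u - w ≤ fl ∧ fl < u - w + r ∧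
      ((co : ℕ) : ZMod (n + 1)) = (cX (γ w) : ℕ) + (⌊fl / (99 * fr)⌋₊ : ZMod (n + 1)) := by
  have hr := h.rpos
  have hu0 : 0 < u := by linarith
  have huI : u ∈ Set.Icc 0 L := ⟨hu0.le, huL.le⟩
  have hLI : L ∈ Set.Icc 0 L := ⟨by linarith, le_rfl⟩
  set p := γ u with hp
  have hout := fun t (ht : 0 ≤ t) (htu : t < u) =>
    h.treeGraded.not_arcIn_of_nonStraddled hγ huI hns ht htu
  have hA0 : ArcIn {p}ᶜ (γ L) (γ L) := ArcIn.refl fun hpL => by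
    have := hγ.injOn hLI huI hpL
    linarith
  obtain ⟨i, him, hiA, hiA'⟩ := exists_step_out (c := c) (m := m)
    (A := {y | ArcIn {p}ᶜ y (γ L)}) (by rw [hc0]; exact hA0) (by rw [hcm]; exact hout tm htm htmu)
  set y := c i with hy
  have hyA : ArcIn {p}ᶜ y (γ L) := hiA i le_rfl
  have hyp : dist p y < r := by
    have h1 := h.dist_add_dist_of_not_arcIn (p := p) (y := c (i + 1)) (z := y) fun harc =>
      hiA' (harc.trans hyA)
    rw [dist_comm (c (i + 1)) y] at h1
    have h2 := hstep i him
    have h3 : 0 ≤ dist (c (i + 1)) p := dist_nonneg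
    linarith
  have hd : 0 < dist p y := by
    obtain ⟨f, l, hl, -, -, h0, -, hS⟩ := hyA
    exact dist_pos.2 fun hpy => hS 0 ⟨le_rfl, hl⟩ (by rw [h0, hpy]; rfl)
  have hxp : dist (γ 0) p = u := by
    rw [hγ 0 ⟨le_rfl, by linarith⟩ u huI, abs_of_nonpos (by linarith)]
    ring
  have hxy := h.dist_add_dist_of_not_arcIn (p := p) (y := γ 0) (z := y) fun harc =>
    hout 0 le_rfl hu0 (harc.trans hyA)
  obtain ⟨ρ, hρ, hρ0, hρ1⟩ := h.geodesic p y
  set d := dist p y with hd'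
  obtain ⟨γ₁, hγ₁, heq, hγρ⟩ := IsGeodesicSegment.exists_concat hu0.le hd.le
    (hγ.mono le_rfl huL.le) hρ hρ0.symm (by rw [hρ1, ← hxy, hxp])
  have hρA : ∀ t, 0 < t → t ≤ d → ArcIn {p}ᶜ (ρ t) (γ L) := by
    intro t ht0 htd
    refine ArcIn.trans (b := y) ?_ hyA
    rw [← hρ1]
    refine (hρ.mono ht0.le le_rfl).arcIn htd fun t' ht' htp => ?_
    have := hρ.injOn (x₁ := t') (x₂ := 0) ⟨by linarith [ht'.1], ht'.2⟩ ⟨le_rfl, hd.le⟩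
      (by rw [hρ0]; exact htp)
    linarith [ht'.1]
  have hγ₁L : γ₁ (u + d) = y := by rw [hγρ d ⟨hd.le, le_rfl⟩, hρ1]
  have hγ₁0 : γ₁ 0 = xhat := by rw [heq ⟨le_rfl, hu0.le⟩, hγ0]
  have hns₁ : NonStraddled PX γ₁ (u + d) u := by
    intro Q hQ t₁ t₂ h0 h1 h2 h3 hQ₁ hQ₂
    have hpQ := h.treeGraded.mem_of_mem_of_mem hQ hγ₁ h0 h1.le h2.le h3 hQ₁ hQ₂
    rw [heq ⟨hu0.le, le_rfl⟩] at hpQ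
    rw [heq ⟨h0, h1.le⟩] at hQ₁
    obtain ⟨s, e, hc⟩ := h.treeGraded.exists_crosses hQ hγ huI hpQ
    have hue := ((hc.2.2.2 u huI).1 hpQ).2
    have heu : e = u := by
      refine le_antisymm ?_ hue
      by_contra! hlt
      exact hns Q hQ t₁ e h0 h1 hlt hc.2.2.1 hQ₁ hc.end_mem
    have hpr := h.proj_end_eq hγ hQ hc
    rw [heu] at hpr
    obtain ⟨f, l, hl, hfc, hfi, hf0, hf1, hfS⟩ := hρA (t₂ - u) (by linarith) (by linarith)
    have hq : f 0 ∈ Q := by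
      rw [hf0, ← hγρ (t₂ - u) ⟨by linarith, by linarith⟩, add_sub_cancel]
      exact hQ₂
    obtain ⟨z, hz, -, hzQ, hzmax⟩ := exists_last_mem (h.treeGraded.closed Q hQ)
      hfc.continuousOn (c := 0) ⟨le_rfl, hl⟩ hq
    refine hfS z hz ?_
    rw [Set.mem_singleton_iff, hp, ← hpr, ← hf1]
    refine (h.eq_proj_of_arcIn hQ hzQ ?_).symm
    refine arcIn_of_subinterval hz.2 hfc (hfi.mono (Set.Icc_subset_Icc_left hz.1)) fun t ht => ?_
    by_cases htQ : f t ∈ Q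
    · right
      rw [le_antisymm (hzmax t ⟨hz.1.trans ht.1, ht.2⟩ htQ) ht.1]; rfl
    · exact Or.inl htQ
  have hend : ∀ Q s e, LongAt PX r xhat proj cP γ₁ (u + d) Q s e → e ≤ w := by
    intro Q s e hl
    have h1 := h.longAt_lt hγ₁ hγ₁0 hl
    have h2 := hl.2.1.1
    have h3 := hl.2.1.2.2.1
    have hsu : s < u := by linarith
    have heu : e ≤ u := by
      by_contra! heu
      exact hns₁ Q hl.1 s e h2 hsu heu h3 hl.2.1.start_mem hl.2.1.end_mem
    have hl' := hl.transfer heu (by linarith) huL.le heq fun t ht =>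
      hns Q hl.1 s t h2 hsu ht.1 ht.2 (by rw [← heq ⟨h2, hsu.le⟩]; exact hl.2.1.start_mem)
    rcases hlong Q s e hl' with h4 | h4 <;> linarith
  have hctx₁ : w = 0 ∨ ∃ Q s, LongAt PX r xhat proj cP γ₁ (u + d) Q s w := by
    refine hctx.imp_right ?_
    rintro ⟨Q, s, hl⟩
    have h1 := h.longAt_lt hγ hγ0 hl
    have h2 := hl.2.1.1
    have hsu : s < u := by linarith
    refine ⟨Q, s, hl.transfer hwu huL.le (by linarith) heq.symm fun t ht => ?_⟩
    exact hns₁ Q hl.1 s t h2 hsu ht.1 ht.2 (by rw [heq ⟨h2, hsu.le⟩]; exact hl.2.1.start_mem)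
  have hF := h.color_eq_add_floor hcX hγ₁ hγ₁0 ⟨hw0, by linarith⟩ hctx₁ hend
  rw [hγ₁L, heq ⟨hw0, hwu⟩, hcolor i him] at hF
  refine ⟨_, ?_, ?_, hF⟩
  · refine h.treeGraded.le_floorLen (by linarith) fun t ht P hP hsub => ?_
    by_contra! htu
    exact hns₁ P hP t (u + d) (hw0.trans ht.1) htu (by linarith) le_rfl
      (hsub ⟨t, ⟨le_rfl, ht.2⟩, rfl⟩) (hsub ⟨u + d, ⟨ht.2, le_rfl⟩, rfl⟩)
  · have := h.treeGraded.floorLen_le (γ := γ₁) (show w ≤ u + d by linarith)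
    linarith

end ColoringSetup

end Windows

section LongPieceCrossing

variable {X : Type*} [MetricSpace X] {PX : Set (Set X)} {n : ℕ} {r fr : ℝ} {xhat : X}
  {proj : Set X → X → X} {cP : Set X → X → Fin (n + 1)}

/-- Being a long piece before the parameter `s` depends only on the geodesic up to `s`,
provided the geodesic runs through another piece right after `s`. -/
theorem LongAt.transfer_of_crosses (hT : IsTreeGraded X PX) {γ γ₁ : ℝ → X} {L L₁ s e : ℝ}
    (hγ : IsGeodesicSegment γ 0 L) {P Q : Set X} (hP : P ∈ PX) (hne : Q ≠ P)
    (hc : Crosses γ L P s e) (hse : s < e) {s' e' : ℝ}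
    (hl : LongAt PX r xhat proj cP γ₁ L₁ Q s' e') (he' : e' ≤ s) (hL₁ : s ≤ L₁)
    (heq : Set.EqOn γ₁ γ (Set.Icc 0 s)) : LongAt PX r xhat proj cP γ L Q s' e' := by
  have h1 := hc.2.2.1
  have h2 := hl.2.1.1
  have h3 := hl.2.1.2.1
  refine hl.transfer he' hL₁ (by linarith) heq fun t ht htQ => hne ?_
  have hQs : γ e' ∈ Q := by
    rw [← heq ⟨h2.trans h3, he'⟩]
    exact hl.2.1.end_mem
  have ht0 : s < min t e := lt_min ht.1 hse
  have ht1 := min_le_left t e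
  have ht2 := min_le_right t e
  exact hT.not_shared hγ hl.1 hP hc.1 ht0 (by linarith)
    (hT.mem_of_mem_of_mem hl.1 hγ (h2.trans h3) he' ht.1.le ht.2 hQs htQ)
    (hT.mem_of_mem_of_mem hl.1 hγ (h2.trans h3) (by linarith) ht1 ht.2 hQs htQ)
    hc.start_mem (hc.mem ht0.le ht2)

namespace ColoringSetup

/-- A geodesic from the base point to a point `z` projecting to `P` away from the base point
of `P` can be chosen to follow `γ` up to the base point of `P`. -/
theorem exists_geodesic_through (h : ColoringSetup X PX n r fr xhat proj cP) {γ : ℝ → X} {L : ℝ}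
    (hγ : IsGeodesicSegment γ 0 L) (hγ0 : γ 0 = xhat) {P : Set X} (hP : P ∈ PX) {s e : ℝ}
    (hc : Crosses γ L P s e) {z : X} (hz : proj P z ≠ γ s) :
    ∃ (γ₁ : ℝ → X) (L₁ e₁ : ℝ), IsGeodesicSegment γ₁ 0 L₁ ∧ γ₁ 0 = xhat ∧ γ₁ L₁ = z ∧
      Set.EqOn γ₁ γ (Set.Icc 0 s) ∧ Crosses γ₁ L₁ P s e₁ ∧ γ₁ e₁ = proj P z ∧ s < e₁ ∧
      e₁ - s = dist (γ s) (proj P z) ∧ L₁ - e₁ = dist (proj P z) z := by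
  have hs0 := hc.1
  have hsL := hc.2.1.trans hc.2.2.1
  have hxs : proj P (γ 0) = γ s := h.proj_start_eq hγ hP hc
  have hd := h.dist_eq_of_proj_ne hP (y := γ 0) (z := z) (by rwa [hxs])
  rw [hxs, hγ 0 ⟨le_rfl, by linarith⟩ s ⟨hs0, hsL⟩, abs_of_nonpos (by linarith)] at hd
  have hd2 : dist (γ 0) z = s + dist (γ s) z := by
    have h1 := dist_triangle (γ s) (proj P z) z
    have h2 := dist_triangle (γ 0) (γ s) z
    rw [hγ 0 ⟨le_rfl, by linarith⟩ s ⟨hs0, hsL⟩, abs_of_nonpos (by linarith)] at h2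
    linarith
  obtain ⟨ρ, hρ, hρ0, hρ1⟩ := h.geodesic (γ s) z
  obtain ⟨γ₁, hγ₁, heq, hγρ⟩ := IsGeodesicSegment.exists_concat hs0 dist_nonneg
    (hγ.mono le_rfl hsL) hρ hρ0.symm (by rw [hρ1, hd2])
  have hd0 : 0 ≤ dist (γ s) z := dist_nonneg
  have hγ₁0 : γ₁ 0 = γ 0 := heq ⟨le_rfl, hs0⟩
  have hγ₁L : γ₁ (s + dist (γ s) z) = z := by rw [hγρ _ ⟨hd0, le_rfl⟩, hρ1]
  obtain ⟨s₁, e₁, hc₁, hs₁, he₁⟩ := h.crosses_of_proj_ne (by linarith) hγ₁ hP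
    (by rwa [hγ₁L, hγ₁0, hxs])
  have h1 := hc₁.1
  have h2 := hc₁.2.1
  have h3 := hc₁.2.2.1
  rw [hγ₁0, hxs] at hs₁
  have hss : s₁ = s := hγ₁.injOn ⟨h1, by linarith⟩ ⟨hs0, by linarith⟩
    (by rw [hs₁, heq ⟨hs0, le_rfl⟩])
  subst hss
  rw [hγ₁L] at he₁
  refine ⟨γ₁, _, e₁, hγ₁, by rw [hγ₁0, hγ0], hγ₁L, heq, hc₁, he₁,
    lt_of_le_of_ne h2 fun h => hz (by rw [← he₁, ← h, hs₁]), ?_, ?_⟩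
  · rw [← hs₁, ← he₁, hγ₁ s₁ ⟨h1, by linarith⟩ e₁ ⟨by linarith, h3⟩, abs_of_nonpos (by linarith)]
    ring
  · conv_rhs => rw [← he₁]
    nth_rewrite 2 [← hγ₁L]
    rw [hγ₁ e₁ ⟨by linarith, h3⟩ _ ⟨by linarith, le_rfl⟩, abs_of_nonpos (by linarith)]
    ring

variable {cX : X → Fin (n + 1)} {γ : ℝ → X} {L : ℝ}

/-- The color of a point close to its projection `y` to a long piece `P` of `γ`, when `y` is
outside of the component of the base point of `P`. -/
theorem color_of_proj_not_mem (h : ColoringSetup X PX n r fr xhat proj cP)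
    (hcX : ∀ (γ : ℝ → X) (L : ℝ), 0 ≤ L → IsGeodesicSegment γ 0 L → γ 0 = xhat →
      ColorValue PX r fr xhat proj cP γ L (cX (γ L)))
    (hγ : IsGeodesicSegment γ 0 L) (hγ0 : γ 0 = xhat) {w : ℝ} (hw0 : 0 ≤ w)
    (hctx : w = 0 ∨ ∃ Q s, LongAt PX r xhat proj cP γ L Q s w) {P : Set X} {s e : ℝ}
    (hP : LongAt PX r xhat proj cP γ L P s e) (hws : w ≤ s)
    (hother : ∀ Q s' e', LongAt PX r xhat proj cP γ L Q s' e' → Q ≠ P → e' ≤ w ∨ e ≤ s')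
    {z : X} (hzr : dist (proj P z) z < r) (hz : proj P z ∉ pieceComp r xhat proj cP P) :
    ((cX z : ℕ) : ZMod (n + 1)) =
      (cX (γ w) : ℕ) + (⌊(s - w) / (99 * fr)⌋₊ : ZMod (n + 1)) + (cP P (proj P z) : ℕ) := by
  have hr := h.rpos
  have hT := h.treeGraded
  have hs0 := hP.2.1.1
  have hlt := h.longAt_lt hγ hγ0 hP
  have hxs : proj P xhat = γ s := by rw [← hγ0, h.proj_start_eq hγ hP.1 hP.2.1]
  have hzs : proj P z ≠ γ s := fun h' => hz (by rw [h', ← hxs]; exact h.self_mem_pieceComp hP.1)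
  obtain ⟨γ₁, L₁, e₁, hγ₁, hγ₁0, hγ₁L, heq, hc₁, he₁, hse₁, -, hLe⟩ :=
    h.exists_geodesic_through hγ hγ0 hP.1 hP.2.1 hzs
  have heL := hc₁.2.2.1
  have hP₁ : LongAt PX r xhat proj cP γ₁ L₁ P s e₁ := ⟨hP.1, hc₁, by rwa [he₁]⟩
  have hlt₁ := h.longAt_lt hγ₁ hγ₁0 hP₁
  have h1 : ((cX (γ₁ L₁) : ℕ) : ZMod (n + 1)) = (cX (γ₁ e₁) : ℕ) := by
    rw [h.color_eq_add_floor hcX hγ₁ hγ₁0 (w := e₁) ⟨by linarith, heL⟩ (Or.inr ⟨P, s, hP₁⟩)]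
    · have hle := hT.floorLen_le (γ := γ₁) heL
      have : floorLen PX γ₁ e₁ L₁ / (99 * fr) < 1 := by
        have := h.rlefr
        rw [div_lt_one (by linarith)]
        linarith
      rw [Nat.floor_eq_zero.2 this, Nat.cast_zero, add_zero]
    · intro Q s' e' hl
      by_cases hQ : Q = P
      · subst hQ
        exact (hl.2.1.unique hc₁).2.le
      · have h2 := h.longAt_lt hγ₁ hγ₁0 hl
        have h3 := hl.2.1.2.2.1
        rcases h.longAt_disjoint hγ₁ hγ₁0 hQ hl hP₁ with h4 | h4 <;> linarith
  have hγe := hγ₁.mono le_rfl heL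
  have hP₂ : LongAt PX r xhat proj cP γ₁ e₁ P s e₁ :=
    hP₁.transfer le_rfl heL le_rfl (fun _ _ => rfl) fun t ht => by linarith [ht.1, ht.2]
  have h2 := h.color_eq_add_color hcX hγe hγ₁0 hP₂
  set v := s + r / 2 with hv
  have hvL : v ≤ L₁ := by linarith
  have hγv := hγ₁.mono le_rfl hvL
  have hcv : Crosses γ₁ v P s v := by
    refine ⟨hs0, by linarith, le_rfl, fun t ht => ?_⟩
    rw [hc₁.2.2.2 t ⟨ht.1, ht.2.trans hvL⟩]
    exact and_congr_right fun _ => ⟨fun _ => ht.2, fun h => h.trans (by linarith)⟩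
  have hPv : ∀ s' e', ¬ LongAt PX r xhat proj cP γ₁ v P s' e' := by
    intro s' e' hl
    refine hl.2.2 ?_
    rw [(hl.2.1.unique hcv).2]
    refine h.mem_pieceComp_of_dist_le hP.1 hcv.end_mem ?_
    rw [hxs, ← heq ⟨hs0, le_rfl⟩, hγv s ⟨hs0, by linarith⟩ v ⟨by linarith, le_rfl⟩,
      abs_of_nonpos (by linarith)]
    linarith
  have h3 : ((cX (γ₁ v) : ℕ) : ZMod (n + 1)) =
      (cX (γ w) : ℕ) + (⌊(s - w) / (99 * fr)⌋₊ : ZMod (n + 1)) := by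
    rw [h.color_eq_add_floor hcX hγv hγ₁0 (w := w) ⟨hw0, by linarith⟩, heq ⟨hw0, hws⟩]
    · have hfl : floorLen PX γ₁ w v = s - w := by
        refine le_antisymm ?_ ?_
        · refine floorLen_le_of_mem ⟨hws, by linarith⟩ hP.1 ?_
          rintro _ ⟨t, ht, rfl⟩
          exact hcv.mem ht.1 ht.2
        · refine hT.le_floorLen (by linarith) fun t ht Q hQ hsub => ?_
          by_contra! hts
          have hQP : Q = P := hT.not_shared hγv hQ hP.1 (a := s) (b := v) hs0 (by linarith) le_rfl
            (hsub ⟨s, ⟨hts.le, by linarith⟩, rfl⟩) (hsub ⟨v, ⟨ht.2, le_rfl⟩, rfl⟩)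
            hcv.start_mem hcv.end_mem
          have := hsub ⟨t, ⟨le_rfl, ht.2⟩, rfl⟩
          rw [hQP] at this
          linarith [((hcv.2.2.2 t ⟨hw0.trans ht.1, ht.2⟩).1 this).1]
      rw [hfl]
    · refine hctx.imp_right ?_
      rintro ⟨Q, s₀, hl⟩
      refine ⟨Q, s₀, LongAt.transfer_of_crosses hT hγv hP.1 ?_ hcv (by linarith) hl hws
        (by linarith [hP.2.1.2.2.1]) heq.symm⟩
      rintro rfl
      linarith [(hl.2.1.unique hP.2.1).2]
    · intro Q s' e' hl
      have hQ : Q ≠ P := by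
        rintro rfl
        exact hPv s' e' hl
      have h4 := h.longAt_lt hγv hγ₁0 hl
      have h5 := hl.2.1.2.2.1
      have h6 : e' ≤ s := by
        rcases hT.crosses_disjoint hγv hl.1 hP.1 hQ hl.2.1 hcv (by linarith) (by linarith)
          with h6 | h6 <;> linarith
      have hl' := LongAt.transfer_of_crosses hT hγ hP.1 hQ hP.2.1 (by linarith) hl h6
        (by linarith) heq
      rcases hother Q s' e' hl' hQ with h7 | h7 <;> linarith
  rw [← hγ₁L, h1, h2, h3, hγ₁L, he₁]

/-- The color of a point close to its projection `y` to a long piece `P` of `γ`, when `y` is in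
the component of the base point of `P`, up to a small error. -/
theorem color_of_proj_mem (h : ColoringSetup X PX n r fr xhat proj cP)
    (hcX : ∀ (γ : ℝ → X) (L : ℝ), 0 ≤ L → IsGeodesicSegment γ 0 L → γ 0 = xhat →
      ColorValue PX r fr xhat proj cP γ L (cX (γ L)))
    (hγ : IsGeodesicSegment γ 0 L) (hγ0 : γ 0 = xhat) {w : ℝ} (hw0 : 0 ≤ w)
    (hctx : w = 0 ∨ ∃ Q s, LongAt PX r xhat proj cP γ L Q s w) {P : Set X} {s e : ℝ}
    (hP : LongAt PX r xhat proj cP γ L P s e) (hws : w ≤ s)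
    (hother : ∀ Q s' e', LongAt PX r xhat proj cP γ L Q s' e' → Q ≠ P → e' ≤ w ∨ e ≤ s')
    {z : X} (hzr : dist (proj P z) z < r) (hz : proj P z ∈ pieceComp r xhat proj cP P)
    (hzs : proj P z ≠ γ s) :
    ∃ fl, s - w ≤ fl ∧ fl ≤ s - w + 9 * fr ∧
      ((cX z : ℕ) : ZMod (n + 1)) = (cX (γ w) : ℕ) + (⌊fl / (99 * fr)⌋₊ : ZMod (n + 1)) := by
  have hr := h.rpos
  have hrf := h.rlefr
  have hT := h.treeGraded
  have hs0 := hP.2.1.1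
  have hlt := h.longAt_lt hγ hγ0 hP
  have hxs : proj P xhat = γ s := by rw [← hγ0, h.proj_start_eq hγ hP.1 hP.2.1]
  obtain ⟨γ₁, L₁, e₁, hγ₁, hγ₁0, hγ₁L, heq, hc₁, he₁, hse₁, hes, hLe⟩ :=
    h.exists_geodesic_through hγ hγ0 hP.1 hP.2.1 hzs
  have heL := hc₁.2.2.1
  have hd := h.dist_le_of_mem_pieceComp hP.1 hz
  rw [hxs, ← hes] at hd
  have hF := h.color_eq_add_floor hcX hγ₁ hγ₁0 (w := w) ⟨hw0, by linarith⟩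
    (by
      refine hctx.imp_right ?_
      rintro ⟨Q, s₀, hl⟩
      refine ⟨Q, s₀, LongAt.transfer_of_crosses hT hγ₁ hP.1 ?_ hc₁ hse₁ hl hws
        (by linarith [hP.2.1.2.2.1]) heq.symm⟩
      rintro rfl
      linarith [(hl.2.1.unique hP.2.1).2])
    (by
      intro Q s' e' hl
      have hQ : Q ≠ P := by
        rintro rfl
        refine hl.2.2 ?_
        rwa [(hl.2.1.unique hc₁).2, he₁]
      have h4 := h.longAt_lt hγ₁ hγ₁0 hl
      have h5 := hl.2.1.2.2.1
      have h6 : e' ≤ s := by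
        rcases hT.crosses_disjoint hγ₁ hl.1 hP.1 hQ hl.2.1 hc₁ (by linarith) hse₁
          with h6 | h6 <;> linarith
      have hl' := LongAt.transfer_of_crosses hT hγ hP.1 hQ hP.2.1 (by linarith) hl h6
        (by linarith) heq
      rcases hother Q s' e' hl' hQ with h7 | h7 <;> linarith)
  rw [hγ₁L, heq ⟨hw0, hws⟩] at hF
  refine ⟨_, ?_, ?_, hF⟩
  · refine hT.le_floorLen (by linarith) fun t ht Q hQ hsub => ?_
    by_contra! hts
    have hQP : Q = P := hT.not_shared hγ₁ hQ hP.1 (a := s) (b := e₁) hs0 hse₁ heL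
      (hsub ⟨s, ⟨hts.le, by linarith⟩, rfl⟩) (hsub ⟨e₁, ⟨by linarith, heL⟩, rfl⟩)
      hc₁.start_mem hc₁.end_mem
    have := hsub ⟨t, ⟨le_rfl, ht.2⟩, rfl⟩
    rw [hQP] at this
    linarith [((hc₁.2.2.2 t ⟨hw0.trans ht.1, ht.2⟩).1 this).1]
  · have := hT.floorLen_le (γ := γ₁) (show w ≤ L₁ by linarith)
    linarith

/-- An `r`-chain of color `co` along `γ` leaving a long piece `P` of `γ` through its base point
forces `P` to be short, and determines `co`. -/
theorem color_of_longAt (h : ColoringSetup X PX n r fr xhat proj cP)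
    (hcX : ∀ (γ : ℝ → X) (L : ℝ), 0 ≤ L → IsGeodesicSegment γ 0 L → γ 0 = xhat →
      ColorValue PX r fr xhat proj cP γ L (cX (γ L)))
    (hγ : IsGeodesicSegment γ 0 L) (hγ0 : γ 0 = xhat) {tm : ℝ} (htm : 0 ≤ tm)
    {co : Fin (n + 1)} {m : ℕ} {c : ℕ → X} (hc0 : c 0 = γ L) (hcm : c m = γ tm)
    (hcolor : ∀ i < m, cX (c i) = co) (hstep : ∀ i < m, dist (c i) (c (i + 1)) < r)
    {w : ℝ} (hw0 : 0 ≤ w) (hctx : w = 0 ∨ ∃ Q s, LongAt PX r xhat proj cP γ L Q s w)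
    {P : Set X} {s e : ℝ} (hP : LongAt PX r xhat proj cP γ L P s e) (hws : w ≤ s)
    (htms : tm ≤ s)
    (hother : ∀ Q s' e', LongAt PX r xhat proj cP γ L Q s' e' → Q ≠ P → e' ≤ w ∨ e ≤ s') :
    e - s ≤ 10 * fr ∧ ((co : ℕ) : ZMod (n + 1)) = (cX (γ e) : ℕ) ∧
      ∃ M : ℕ, s - w < 99 * fr * M ∧ 99 * fr * M ≤ s - w + 9 * fr ∧
        ((co : ℕ) : ZMod (n + 1)) = (cX (γ w) : ℕ) + (M : ZMod (n + 1)) := by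
  have hr := h.rpos
  have hrf := h.rlefr
  have hf : 0 < 99 * fr := by linarith
  have hs0 := hP.2.1.1
  have heL := hP.2.1.2.2.1
  have hlt := h.longAt_lt hγ hγ0 hP
  have hxs : proj P xhat = γ s := by rw [← hγ0, h.proj_start_eq hγ hP.1 hP.2.1]
  have hproj0 : proj P (c 0) = γ e := by rw [hc0, h.proj_end_eq hγ hP.1 hP.2.1]
  have hprojm : proj P (c m) = γ s := by
    rw [hcm]
    refine h.eq_proj_of_arcIn hP.1 hP.2.1.start_mem (ArcIn.symm ?_)
    refine (hγ.mono htm (by linarith)).arcIn htms fun t ht => ?_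
    by_cases htP : γ t ∈ P
    · have := ((hP.2.1.2.2.2 t ⟨htm.trans ht.1, by linarith [ht.2]⟩).1 htP).1
      rw [le_antisymm ht.2 this]
      exact Or.inr rfl
    · exact Or.inl htP
  obtain ⟨i, him, hi, hi'⟩ := exists_step_out (c := c) (m := m)
    (A := {y | proj P y ∉ pieceComp r xhat proj cP P})
    (by rw [Set.mem_ofPred_eq, hproj0]; exact hP.2.2)
    (by
      rw [Set.mem_ofPred_eq, hprojm, ← hxs, not_not]
      exact h.self_mem_pieceComp hP.1)
  rw [Set.mem_ofPred_eq, not_not] at hi'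
  have hi : ∀ j ≤ i, proj P (c j) ∉ pieceComp r xhat proj cP P := hi
  have hdist : ∀ j < m, proj P (c (j + 1)) ≠ proj P (c j) →
      dist (proj P (c j)) (c j) < r ∧ dist (proj P (c (j + 1))) (c (j + 1)) < r ∧
      dist (proj P (c j)) (proj P (c (j + 1))) < r := by
    intro j hj hne
    have h1 := h.dist_eq_of_proj_ne hP.1 hne
    have h2 := hstep j hj
    have h3 : 0 ≤ dist (c j) (proj P (c j)) := dist_nonneg
    have h4 : 0 ≤ dist (proj P (c j)) (proj P (c (j + 1))) := dist_nonneg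
    have h5 : 0 ≤ dist (proj P (c (j + 1))) (c (j + 1)) := dist_nonneg
    rw [dist_comm (proj P (c j)) (c j)]
    exact ⟨by linarith, by linarith, by linarith⟩
  have hdr : ∀ j < m, dist (proj P (c j)) (proj P (c (j + 1))) < r := by
    intro j hj
    by_cases hne : proj P (c (j + 1)) = proj P (c j)
    · rw [hne, dist_self]; exact hr
    · exact (hdist j hj hne).2.2
  have hne : proj P (c (i + 1)) ≠ proj P (c i) := fun h' => hi i le_rfl (h' ▸ hi')
  obtain ⟨hd1, hd2, hd3⟩ := hdist i him hne
  have hnes : proj P (c (i + 1)) ≠ γ s := by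
    intro h'
    refine hi i le_rfl (h.mem_pieceComp_of_dist_le hP.1 (h.projMem P hP.1 _) ?_)
    rw [hxs, ← h', dist_comm]
    linarith
  have him' : i + 1 < m := lt_of_le_of_ne him fun h' => hnes (h' ▸ hprojm)
  have hcol : ∀ j ≤ i, ((co : ℕ) : ZMod (n + 1)) =
      (cX (γ w) : ℕ) + (⌊(s - w) / (99 * fr)⌋₊ : ZMod (n + 1)) + (cP P (proj P (c j)) : ℕ) := by
    have hform : ∀ j ≤ i, dist (proj P (c j)) (c j) < r → ((co : ℕ) : ZMod (n + 1)) =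
        (cX (γ w) : ℕ) + (⌊(s - w) / (99 * fr)⌋₊ : ZMod (n + 1)) +
          (cP P (proj P (c j)) : ℕ) := by
      intro j hj hd
      rw [← h.color_of_proj_not_mem hcX hγ hγ0 hw0 hctx hP hws hother hd (hi j hj),
        hcolor j (by omega)]
    intro j hj
    induction hj using Nat.decreasingInduction with
    | self => exact hform i le_rfl hd1
    | of_succ k hk ih =>
      by_cases hk' : proj P (c (k + 1)) = proj P (c k)
      · rwa [hk'] at ih
      · exact hform k hk.le (hdist k (by omega) hk').1
  have hsame : ∀ j ≤ i, cP P (proj P (c j)) = cP P (proj P (c i)) := fun j hj =>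
    ZMod.natCast_fin_inj (add_left_cancel ((hcol j hj).symm.trans (hcol i le_rfl)))
  have hne0 : cP P (proj P (c i)) ≠ 0 := by
    intro h0
    refine hi i le_rfl (mem_pieceComp_of_dist_lt hi' (h.projMem P hP.1 _) h0 ?_)
    rwa [dist_comm]
  have hbd : dist (γ e) (proj P (c i)) ≤ fr := by
    refine h.nonzeroBounded P hP.1 _ hne0 _ _
      ⟨i, fun j => proj P (c j), hproj0, rfl, fun j hj => ⟨h.projMem P hP.1 _, hsame j hj⟩,
        fun j hj => hdr j (by omega)⟩
  refine ⟨?_, ?_, ?_⟩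
  · have h1 := h.dist_le_of_mem_pieceComp hP.1 hi'
    rw [hxs] at h1
    have h2 := dist_triangle4 (γ e) (proj P (c i)) (proj P (c (i + 1))) (γ s)
    rw [hγ e ⟨by linarith, heL⟩ s ⟨hs0, by linarith⟩, abs_of_nonneg (by linarith),
      dist_comm _ (γ s)] at h2
    linarith
  · have hpe := h.proj_of_mem hP.1 hP.2.1.end_mem
    rw [h.color_of_proj_not_mem hcX hγ hγ0 hw0 hctx hP hws hother (z := γ e)
      (by rw [hpe, dist_self]; exact hr) (by rw [hpe]; exact hP.2.2), hpe, ← hproj0]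
    exact hcol 0 (Nat.zero_le _)
  · obtain ⟨fl, hfl1, hfl2, hfl3⟩ :=
      h.color_of_proj_mem hcX hγ hγ0 hw0 hctx hP hws hother hd2 hi' hnes
    rw [hcolor _ him'] at hfl3
    have hfl0 : 0 ≤ fl := by linarith
    have hle : ⌊(s - w) / (99 * fr)⌋₊ ≤ ⌊fl / (99 * fr)⌋₊ :=
      Nat.floor_mono (by gcongr)
    have hlt' : ⌊(s - w) / (99 * fr)⌋₊ < ⌊fl / (99 * fr)⌋₊ := by
      refine lt_of_le_of_ne hle fun heq => hne0 ?_
      have h1 := hfl3.symm.trans (hcol i le_rfl)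
      rw [heq] at h1
      exact ZMod.natCast_fin_inj (by simpa using h1.symm)
    refine ⟨_, ?_, ?_, hfl3⟩
    · have h1 := Nat.lt_floor_add_one ((s - w) / (99 * fr))
      rw [div_lt_iff₀ hf] at h1
      have h2 : (⌊(s - w) / (99 * fr)⌋₊ : ℝ) + 1 ≤ ⌊fl / (99 * fr)⌋₊ := by exact_mod_cast hlt'
      nlinarith
    · have h1 := Nat.floor_le (show 0 ≤ fl / (99 * fr) by positivity)
      rw [le_div_iff₀ hf] at h1
      linarith

end ColoringSetup

end LongPieceCrossing

section Assembly

variable {X : Type*} [MetricSpace X] {PX : Set (Set X)} {n : ℕ} {r fr : ℝ} {xhat : X}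
  {proj : Set X → X → X} {cP : Set X → X → Fin (n + 1)} {cX : X → Fin (n + 1)} {γ : ℝ → X} {L : ℝ}

namespace ColoringSetup

/-- Outside of the long pieces of `γ`, a point of `γ` interior to no piece can be found within
bounded distance. -/
theorem exists_nonStraddled (h : ColoringSetup X PX n r fr xhat proj cP)
    (hγ : IsGeodesicSegment γ 0 L) (hγ0 : γ 0 = xhat) {t : ℝ}
    (hlong : ∀ Q s e, LongAt PX r xhat proj cP γ L Q s e → e ≤ t ∨ t ≤ s) :
    ∃ u, t ≤ u ∧ u ≤ t + 8 * fr ∧ NonStraddled PX γ L u ∧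
      ∀ Q s e, LongAt PX r xhat proj cP γ L Q s e → t ≤ s → u ≤ s := by
  have hr := h.rpos
  have hrf := h.rlefr
  by_cases hns : NonStraddled PX γ L t
  · exact ⟨t, le_rfl, by linarith, hns, fun _ _ _ _ hts => hts⟩
  unfold NonStraddled at hns
  push Not at hns
  obtain ⟨P, hP, t₁, t₂, h1, h2, h3, h4, hP₁, hP₂⟩ := hns
  obtain ⟨s, e, hc⟩ := h.treeGraded.exists_crosses hP hγ (t := t₁) ⟨h1, by linarith⟩ hP₁
  have hs := ((hc.2.2.2 t₁ ⟨h1, by linarith⟩).1 hP₁).1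
  have he := ((hc.2.2.2 t₂ ⟨by linarith, h4⟩).1 hP₂).2
  have hs0 := hc.1
  have heL := hc.2.2.1
  have hmem : γ e ∈ pieceComp r xhat proj cP P := by
    by_contra hmem
    rcases hlong P s e ⟨hP, hc, hmem⟩ with h5 | h5 <;> linarith
  have hd := h.dist_le_of_mem_pieceComp hP hmem
  rw [← hγ0, h.proj_start_eq hγ hP hc, hγ s ⟨hs0, by linarith⟩ e ⟨by linarith, heL⟩,
    abs_of_nonpos (by linarith)] at hd
  refine ⟨e, by linarith, by linarith, ?_, ?_⟩
  · intro Q hQ t₁' t₂' h1' h2' h3' h4' hQ₁ hQ₂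
    have hlt : max s t₁' < e := max_lt (by linarith) h2'
    have hle₁ := le_max_left s t₁'
    have hle₂ := le_max_right s t₁'
    have hQP : Q = P := h.treeGraded.not_shared hγ hQ hP (hs0.trans hle₁) hlt heL
      (h.treeGraded.mem_of_mem_of_mem hQ hγ h1' hle₂ (by linarith) h4' hQ₁ hQ₂)
      (h.treeGraded.mem_of_mem_of_mem hQ hγ h1' h2'.le h3'.le h4' hQ₁ hQ₂)
      (hc.mem hle₁ hlt.le) hc.end_mem
    rw [hQP] at hQ₂
    linarith [((hc.2.2.2 t₂' ⟨by linarith, h4'⟩).1 hQ₂).2]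
  · intro Q s' e' hl hts
    have hlt := h.longAt_lt hγ hγ0 hl
    have hQP : P ≠ Q := by
      rintro rfl
      linarith [(hl.2.1.unique hc).1]
    rcases h.treeGraded.crosses_disjoint hγ hP hl.1 hQP hc hl.2.1 (by linarith) (by linarith)
      with h5 | h5 <;> linarith

theorem exists_last_longAt (h : ColoringSetup X PX n r fr xhat proj cP)
    (hγ : IsGeodesicSegment γ 0 L) (hγ0 : γ 0 = xhat) {t : ℝ}
    (hex : ∃ Q s e, LongAt PX r xhat proj cP γ L Q s e ∧ e ≤ t) :
    ∃ Q s e, LongAt PX r xhat proj cP γ L Q s e ∧ e ≤ t ∧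
      ∀ Q' s' e', LongAt PX r xhat proj cP γ L Q' s' e' → e' ≤ t → e' ≤ e := by
  have hr := h.rpos
  set E := {e | ∃ Q s, LongAt PX r xhat proj cP γ L Q s e ∧ e ≤ t} with hE
  have hbdd : BddAbove E := ⟨t, by rintro e ⟨Q, s, -, he⟩; exact he⟩
  have hne : E.Nonempty := by
    obtain ⟨Q, s, e, hl, he⟩ := hex
    exact ⟨e, Q, s, hl, he⟩
  obtain ⟨e, ⟨Q, s, hl, he⟩, hlt⟩ := exists_lt_of_lt_csSup hne (sub_lt_self (sSup E) hr)
  refine ⟨Q, s, e, hl, he, fun Q' s' e' hl' he' => ?_⟩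
  by_contra! hee
  have h1 := le_csSup hbdd (show e' ∈ E from ⟨Q', s', hl', he'⟩)
  have h2 := h.longAt_lt hγ hγ0 hl
  have h3 := h.longAt_lt hγ hγ0 hl'
  have hQ : Q ≠ Q' := by
    rintro rfl
    linarith [(hl.2.1.unique hl'.2.1).2]
  rcases h.longAt_disjoint hγ hγ0 hQ hl hl' with h4 | h4 <;> linarith

theorem exists_first_longAt (h : ColoringSetup X PX n r fr xhat proj cP)
    (hγ : IsGeodesicSegment γ 0 L) (hγ0 : γ 0 = xhat) {t : ℝ}
    (hex : ∃ Q s e, LongAt PX r xhat proj cP γ L Q s e ∧ t ≤ s) :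
    ∃ Q s e, LongAt PX r xhat proj cP γ L Q s e ∧ t ≤ s ∧
      ∀ Q' s' e', LongAt PX r xhat proj cP γ L Q' s' e' → t ≤ s' → Q' ≠ Q → e ≤ s' := by
  have hr := h.rpos
  set S := {s | ∃ Q e, LongAt PX r xhat proj cP γ L Q s e ∧ t ≤ s} with hS
  have hbdd : BddBelow S := ⟨t, by rintro e ⟨Q, s, -, he⟩; exact he⟩
  have hne : S.Nonempty := by
    obtain ⟨Q, s, e, hl, he⟩ := hex
    exact ⟨s, Q, e, hl, he⟩
  obtain ⟨s, ⟨Q, e, hl, hs⟩, hlt⟩ := exists_lt_of_csInf_lt hne (lt_add_of_pos_right (sInf S) hr)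
  refine ⟨Q, s, e, hl, hs, fun Q' s' e' hl' hs' hQ => ?_⟩
  have h1 := csInf_le hbdd (show s' ∈ S from ⟨Q', e', hl', hs'⟩)
  have h3 := h.longAt_lt hγ hγ0 hl'
  rcases h.longAt_disjoint hγ hγ0 hQ hl' hl with h4 | h4
  · linarith
  · exact h4

variable {co : Fin (n + 1)} {m : ℕ} {c : ℕ → X} {tm w : ℝ}

/-- An `r`-chain of color `co` along `γ` passing a stretch of `γ` without long pieces, on which the
floored length contributes exactly `N`. -/
theorem color_eq_add_natCast (h : ColoringSetup X PX n r fr xhat proj cP)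
    (hcX : ∀ (γ : ℝ → X) (L : ℝ), 0 ≤ L → IsGeodesicSegment γ 0 L → γ 0 = xhat →
      ColorValue PX r fr xhat proj cP γ L (cX (γ L)))
    (hγ : IsGeodesicSegment γ 0 L) (hγ0 : γ 0 = xhat) (htm : 0 ≤ tm)
    (hc0 : c 0 = γ L) (hcm : c m = γ tm)
    (hcolor : ∀ i < m, cX (c i) = co) (hstep : ∀ i < m, dist (c i) (c (i + 1)) < r)
    (hw0 : 0 ≤ w) (hctx : w = 0 ∨ ∃ Q s, LongAt PX r xhat proj cP γ L Q s w)
    {t : ℝ} (htmt : tm < t) (hwt : w ≤ t) (htL : t + 8 * fr < L)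
    (hlong : ∀ Q s e, LongAt PX r xhat proj cP γ L Q s e → e ≤ w ∨ t ≤ s) {N : ℕ}
    (hN₁ : 99 * fr * N ≤ t - w) (hN₂ : t - w + 9 * fr ≤ 99 * fr * (N + 1)) :
    ((co : ℕ) : ZMod (n + 1)) = (cX (γ w) : ℕ) + (N : ZMod (n + 1)) := by
  have hr := h.rpos
  have hrf := h.rlefr
  have hf : 0 < 99 * fr := by linarith
  obtain ⟨u, htu, hut, hns, hu⟩ := h.exists_nonStraddled hγ hγ0 (t := t) fun Q s e hl =>
    (hlong Q s e hl).imp_left fun h1 => h1.trans hwt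
  obtain ⟨fl, h1, h2, h3⟩ := h.color_of_window hcX hγ hγ0 htm hc0 hcm hcolor hstep hw0 hctx
    (u := u) (by linarith) (by linarith) (by linarith)
    (fun Q s e hl => (hlong Q s e hl).imp_right (hu Q s e hl)) hns
  have hfl : ⌊fl / (99 * fr)⌋₊ = N := by
    refine (Nat.floor_eq_iff (div_nonneg (by linarith) hf.le)).2 ⟨?_, ?_⟩
    · rw [le_div_iff₀ hf]
      linarith
    · rw [div_lt_iff₀ hf]
      linarith
  rw [h3, hfl]

theorem natCast_add_one_ne (h : ColoringSetup X PX n r fr xhat proj cP) {a : ZMod (n + 1)} :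
    a + 1 ≠ a := by
  have : Fact (1 < n + 1) := ⟨by linarith [h.npos]⟩
  simp

/-- There is only a bounded stretch of `γ` between `w`, or the end of the chain, and the next long
piece of `γ`. -/
theorem longAt_start_le (h : ColoringSetup X PX n r fr xhat proj cP)
    (hcX : ∀ (γ : ℝ → X) (L : ℝ), 0 ≤ L → IsGeodesicSegment γ 0 L → γ 0 = xhat →
      ColorValue PX r fr xhat proj cP γ L (cX (γ L)))
    (hγ : IsGeodesicSegment γ 0 L) (hγ0 : γ 0 = xhat) (htm : 0 ≤ tm)
    (hc0 : c 0 = γ L) (hcm : c m = γ tm)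
    (hcolor : ∀ i < m, cX (c i) = co) (hstep : ∀ i < m, dist (c i) (c (i + 1)) < r)
    (hw0 : 0 ≤ w) (hctx : w = 0 ∨ ∃ Q s, LongAt PX r xhat proj cP γ L Q s w)
    {P : Set X} {s e : ℝ} (hP : LongAt PX r xhat proj cP γ L P s e)
    (hother : ∀ Q s' e', LongAt PX r xhat proj cP γ L Q s' e' → Q ≠ P → e' ≤ w ∨ e ≤ s') :
    s ≤ max w tm + 10 * fr := by
  by_contra! hlt
  have hr := h.rpos
  have hrf := h.rlefr
  have hw := le_max_left w tm
  have ht := le_max_right w tm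
  have hse := h.longAt_lt hγ hγ0 hP
  have heL := hP.2.1.2.2.1
  obtain ⟨-, -, M, hM₁, hM₂, hM⟩ := h.color_of_longAt hcX hγ hγ0 htm hc0 hcm hcolor hstep hw0 hctx
    hP (by linarith) (by linarith) hother
  obtain ⟨N, rfl⟩ : ∃ N, M = N + 1 := by
    refine Nat.exists_eq_succ_of_ne_zero ?_
    rintro rfl
    norm_num at hM₁
    linarith
  push_cast at hM₁ hM₂ hM
  have hN := h.color_eq_add_natCast hcX hγ hγ0 htm hc0 hcm hcolor hstep hw0 hctx
    (t := s - 10 * fr) (N := N) (by linarith) (by linarith) (by linarith)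
    (fun Q s' e' hl => by
      by_cases hQ : Q = P
      · subst hQ
        right
        linarith [(hl.2.1.unique hP.2.1).1]
      · refine (hother Q s' e' hl hQ).imp_right fun h1 => by linarith)
    (by linarith) (by linarith)
  exact h.natCast_add_one_ne ((add_assoc _ _ _).trans (hM.symm.trans hN))

theorem sub_le_of_chain (h : ColoringSetup X PX n r fr xhat proj cP)
    (hcX : ∀ (γ : ℝ → X) (L : ℝ), 0 ≤ L → IsGeodesicSegment γ 0 L → γ 0 = xhat →
      ColorValue PX r fr xhat proj cP γ L (cX (γ L)))
    (hγ : IsGeodesicSegment γ 0 L) (hγ0 : γ 0 = xhat) (htm : 0 ≤ tm)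
    (hc0 : c 0 = γ L) (hcm : c m = γ tm)
    (hcolor : ∀ i < m, cX (c i) = co) (hstep : ∀ i < m, dist (c i) (c (i + 1)) < r)
    (hlong : ∀ Q s e, LongAt PX r xhat proj cP γ L Q s e → e ≤ tm ∨ tm ≤ s) :
    L - tm ≤ 140 * fr := by
  by_contra! hlt
  have hr := h.rpos
  have hrf := h.rlefr
  have hf : 0 < 99 * fr := by linarith
  obtain ⟨w, hw0, hwtm, hctx, hw⟩ : ∃ w, 0 ≤ w ∧ w ≤ tm ∧
      (w = 0 ∨ ∃ Q s, LongAt PX r xhat proj cP γ L Q s w) ∧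
      ∀ Q s e, LongAt PX r xhat proj cP γ L Q s e → e ≤ w ∨ tm ≤ s := by
    by_cases hex : ∃ Q s e, LongAt PX r xhat proj cP γ L Q s e ∧ e ≤ tm
    · obtain ⟨Q, s, w, hl, hle, hmax⟩ := h.exists_last_longAt hγ hγ0 hex
      exact ⟨w, hl.2.1.1.trans hl.2.1.2.1, hle, Or.inr ⟨Q, s, hl⟩, fun Q' s' e' hl' =>
        (hlong Q' s' e' hl').imp_left (hmax Q' s' e' hl')⟩
    · push Not at hex
      exact ⟨0, le_rfl, htm, Or.inl rfl, fun Q s e hl =>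
        (hlong Q s e hl).imp_left fun hle => (hex Q s e hl |>.not_ge hle).elim⟩
  by_cases hex : ∃ Q s e, LongAt PX r xhat proj cP γ L Q s e ∧ tm ≤ s
  · obtain ⟨P, s, e, hP, htms, hfirst⟩ := h.exists_first_longAt hγ hγ0 hex
    have hother : ∀ Q s' e', LongAt PX r xhat proj cP γ L Q s' e' → Q ≠ P → e' ≤ w ∨ e ≤ s' :=
      fun Q s' e' hl hQ => (hw Q s' e' hl).imp_right fun h1 => hfirst Q s' e' hl h1 hQ
    have hse := h.longAt_lt hγ hγ0 hP
    have h1 := h.longAt_start_le hcX hγ hγ0 htm hc0 hcm hcolor hstep hw0 hctx hP hother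
    rw [max_eq_right hwtm] at h1
    obtain ⟨h2, h3, -⟩ := h.color_of_longAt hcX hγ hγ0 htm hc0 hcm hcolor hstep hw0 hctx
      hP (hwtm.trans htms) htms hother
    have he0 : 0 ≤ e := by linarith
    have hctx' : e = 0 ∨ ∃ Q s, LongAt PX r xhat proj cP γ L Q s e := Or.inr ⟨P, s, hP⟩
    have hcases : ∀ Q s' e', LongAt PX r xhat proj cP γ L Q s' e' → e' ≤ e ∨ e ≤ s' := by
      intro Q s' e' hl
      by_cases hQ : Q = P
      · subst hQ
        exact Or.inl (hl.2.1.unique hP.2.1).2.le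
      · exact (hother Q s' e' hl hQ).imp_left fun h4 => by linarith
    by_cases hex' : ∃ Q s' e', LongAt PX r xhat proj cP γ L Q s' e' ∧ e ≤ s'
    · obtain ⟨Q, s', e', hQ, hes, hfirst'⟩ := h.exists_first_longAt hγ hγ0 hex'
      have hother' : ∀ Q' s'' e'', LongAt PX r xhat proj cP γ L Q' s'' e'' → Q' ≠ Q →
          e'' ≤ e ∨ e' ≤ s'' :=
        fun Q' s'' e'' hl hQ' => (hcases Q' s'' e'' hl).imp_right fun h4 =>
          hfirst' Q' s'' e'' hl h4 hQ'
      have h4 := h.longAt_start_le hcX hγ hγ0 htm hc0 hcm hcolor hstep he0 hctx' hQ hother'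
      rw [max_eq_left (by linarith)] at h4
      obtain ⟨-, -, M, hM₁, hM₂, -⟩ := h.color_of_longAt hcX hγ hγ0 htm hc0 hcm hcolor hstep he0
        hctx' hQ hes (by linarith) hother'
      have hM : (1 : ℝ) ≤ M := by
        rw [Nat.one_le_cast, Nat.one_le_iff_ne_zero]
        rintro rfl
        norm_num at hM₁
        linarith
      nlinarith
    · push Not at hex'
      have h4 := h.color_eq_add_natCast hcX hγ hγ0 htm hc0 hcm hcolor hstep he0 hctx'
        (t := e + 99 * fr) (N := 1) (by linarith) (by linarith) (by linarith)
        (fun Q s' e' hl => Or.inl ((hcases Q s' e' hl).resolve_right (hex' Q s' e' hl).not_ge))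
        (by norm_num) (by norm_num; linarith)
      rw [Nat.cast_one] at h4
      exact h.natCast_add_one_ne (h4.symm.trans h3)
  · push Not at hex
    have hlong' : ∀ t, ∀ Q s e, LongAt PX r xhat proj cP γ L Q s e → e ≤ w ∨ t ≤ s :=
      fun t Q s e hl => Or.inl ((hw Q s e hl).resolve_right (hex Q s e hl).not_ge)
    set N := ⌊(tm - w + 9 * fr) / (99 * fr)⌋₊ with hN
    have h1 := Nat.floor_le (show 0 ≤ (tm - w + 9 * fr) / (99 * fr) from
      div_nonneg (by linarith) hf.le)
    have h2 := Nat.lt_floor_add_one ((tm - w + 9 * fr) / (99 * fr))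
    rw [le_div_iff₀ hf] at h1
    rw [div_lt_iff₀ hf] at h2
    have h3 := h.color_eq_add_natCast hcX hγ hγ0 htm hc0 hcm hcolor hstep hw0 hctx
      (t := w + 99 * fr * (N + 1) - 9 * fr) (N := N) (by linarith) (by linarith) (by linarith)
      (hlong' _) (by linarith) (by linarith)
    have h4 := h.color_eq_add_natCast hcX hγ hγ0 htm hc0 hcm hcolor hstep hw0 hctx
      (t := w + 99 * fr * (N + 1)) (N := N + 1) (by linarith) (by linarith) (by linarith)
      (hlong' _) (by push_cast; linarith) (by push_cast; linarith)
    push_cast at h4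
    exact h.natCast_add_one_ne ((add_assoc _ _ _).trans (h4.symm.trans h3))

end ColoringSetup

end Assembly

/-- In the Setup, let `γ` be a geodesic from `x̂` to `x` and suppose there is an
`r`-chain from `x` to a point `γ tₘ` on `γ` all of whose points, except possibly the
last one, have the same `c*_X`-color. If every long piece of `γ` meeting the subpath
`γ'` of `γ` between `x` and `γ tₘ` is either contained in `γ'` or meets it only at
`γ tₘ`, then `d(x, γ tₘ) ≤ 140·f(r)`. -/
theorem component_along_geodesic (X : Type*) [MetricSpace X] [CompleteSpace X]
    (PX : Set (Set X)) (n : ℕ) (r fr : ℝ) (xhat : X)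
    (proj : Set X → X → X) (cP : Set X → X → Fin (n + 1))
    (hsetup : ColoringSetup X PX n r fr xhat proj cP)
    (cX : X → Fin (n + 1))
    (hcX : ∀ (γ : ℝ → X) (L : ℝ), 0 ≤ L → IsGeodesicSegment γ 0 L → γ 0 = xhat →
      ColorValue PX r fr xhat proj cP γ L (cX (γ L)))
    (x : X) (γ : ℝ → X) (L : ℝ) (hL : 0 ≤ L)
    (hγ : IsGeodesicSegment γ 0 L) (hγ0 : γ 0 = xhat) (hγL : γ L = x)
    (tm : ℝ) (htm : tm ∈ Set.Icc (0 : ℝ) L)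
    (co : Fin (n + 1)) (m : ℕ) (c : ℕ → X)
    (hc0 : c 0 = x) (hcm : c m = γ tm)
    (hcolor : ∀ i < m, cX (c i) = co)
    (hstep : ∀ i < m, dist (c i) (c (i + 1)) < r)
    (hlong : ∀ P : Set X, IsLongPiece PX r xhat proj cP γ L P →
      (Set.Icc (pieceStart γ L P) (pieceEnd γ L P) ∩ Set.Icc tm L).Nonempty →
      Set.Icc (pieceStart γ L P) (pieceEnd γ L P) ⊆ Set.Icc tm L ∨
      Set.Icc (pieceStart γ L P) (pieceEnd γ L P) ∩ Set.Icc tm L ⊆ {tm}) :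
    dist x (γ tm) ≤ 140 * fr := by
  obtain ⟨htm0, htmL⟩ := htm
  rw [← hγL, hγ L ⟨hL, le_rfl⟩ tm ⟨htm0, htmL⟩, abs_of_nonneg (by linarith)]
  refine hsetup.sub_le_of_chain hcX hγ hγ0 htm0 (hc0.trans hγL.symm) hcm hcolor hstep
    fun Q s e hl => ?_
  have hse := hl.2.1.2.1
  have heL := hl.2.1.2.2.1
  refine or_iff_not_imp_left.2 fun he => ?_
  have h1 := hlong Q ((hsetup.isLongPiece_iff hγ).2 ⟨s, e, hl⟩)
  rw [hl.2.1.pieceStart_eq, hl.2.1.pieceEnd_eq] at h1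
  have hmem : e ∈ Set.Icc s e ∩ Set.Icc tm L := ⟨⟨hse, le_rfl⟩, (not_le.1 he).le, heL⟩
  rcases h1 ⟨e, hmem⟩ with h2 | h2
  · exact (h2 ⟨le_rfl, hse⟩).1
  · exact (he (Set.mem_singleton_iff.1 (h2 hmem)).le).elim
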